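/- Let γ ∈ ℝ^d be a probability distribution with rational entries γ_i = c_i/N, where the c_i are positive integers with ∑_i c_i = N, let Γ denote the associated embedding map, and let η_N be the uniform distribution on N outcomes. Let p, q ∈ ℝ^d be probability distributions with D(p‖γ) > 0, D(q‖γ) > 0, V(p‖γ) > 0 and V(q‖γ) > 0. Let (t_n) be a moderate sequence and set ε_n = e^{−n t_n²}. For ε ≥ 0 define R_n^{th,F}(ε) = (1/n)·sup{ m ∈ ℕ : there exists a probability distribution Q̃ with (Γp)^{⊗n} ⊗ η_N^{⊗m} ≻ Q̃ and 1 − F((Γq)^{⊗m} ⊗ η_N^{⊗n}, Q̃) ≤ ε }. Set ν = (V(p‖γ)/D(p‖γ)) / (V(q‖γ)/D(q‖γ)). Then lim_{n→∞} ( R_n^{th,F}(ε_n) − D(p‖γ)/D(q‖γ) ) / t_n = −(√(2 V(p‖γ)) / D(q‖γ)) · |1 − 1/√ν|. -/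

import Mathlib

open Finset Filter Real Topology

noncomputable section

/-- A probability distribution on a finite type: nonnegative entries summing to 1. -/
def IsProbDist {α : Type*} [Fintype α] (a : α → ℝ) : Prop :=
  (∀ i, 0 ≤ a i) ∧ ∑ i, a i = 1

/-- A sharp distribution: a single entry equal to 1, all others 0. -/
def IsSharp {α : Type*} [Fintype α] (a : α → ℝ) : Prop :=
  ∃ i, a i = 1 ∧ ∀ j, j ≠ i → a j = 0

/-- The uniform distribution: all entries equal to `1 / |α|`. -/
def IsUniform {α : Type*} [Fintype α] (a : α → ℝ) : Prop :=
  ∀ i, a i = 1 / (Fintype.card α : ℝ)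

/-- Tensor (Kronecker) product of two vectors. -/
def tensor {α β : Type*} (a : α → ℝ) (b : β → ℝ) : α × β → ℝ :=
  fun x => a x.1 * b x.2

/-- `n`-fold tensor power of a vector. -/
def tpow {α : Type*} (a : α → ℝ) (n : ℕ) : (Fin n → α) → ℝ :=
  fun f => ∏ j, a (f j)

/-- Shannon entropy (natural logarithm, with the convention `0 · ln 0 = 0`). -/
def shannonH {α : Type*} [Fintype α] (a : α → ℝ) : ℝ :=
  -∑ i, a i * Real.log (a i)

/-- Entropy variance `V(a) = ∑ i, a i (ln a i + H(a))²`. -/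
def entV {α : Type*} [Fintype α] (a : α → ℝ) : ℝ :=
  ∑ i, a i * (Real.log (a i) + shannonH a) ^ 2

/-- Relative entropy `D(a‖b)`. -/
def relD {α : Type*} [Fintype α] (a b : α → ℝ) : ℝ :=
  ∑ i, a i * Real.log (a i / b i)

/-- Relative entropy variance `V(a‖b)`. -/
def relV {α : Type*} [Fintype α] (a b : α → ℝ) : ℝ :=
  ∑ i, a i * (Real.log (a i / b i) - relD a b) ^ 2

/-- Total variation distance. -/
def tvd {α : Type*} [Fintype α] (a b : α → ℝ) : ℝ :=
  (1 / 2) * ∑ i, |a i - b i|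

/-- Fidelity `F(a,b) = (∑ i √(a i · b i))²`. -/
def fid {α : Type*} [Fintype α] (a b : α → ℝ) : ℝ :=
  (∑ i, Real.sqrt (a i * b i)) ^ 2

/-- The entries of `a` sorted in non-increasing order, as a vector on `Fin (card α)`. -/
def descSorted {α : Type*} [Fintype α] (a : α → ℝ) : Fin (Fintype.card α) → ℝ :=
  fun i =>
    a ((Fintype.equivFin α).symm
      (Tuple.sort (fun j => -a ((Fintype.equivFin α).symm j)) i))

/-- `headSum a K = ∑_{1 ≤ i ≤ K} a^↓_i` (1-based indices `i`, comparison `(i : ℝ) ≤ K`,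
equivalently `i ≤ ⌊K⌋`). -/
def headSum {α : Type*} [Fintype α] (a : α → ℝ) (K : ℝ) : ℝ :=
  ∑ i ∈ Finset.univ.filter (fun i : Fin (Fintype.card α) => ((i : ℕ) + 1 : ℝ) ≤ K),
    descSorted a i

/-- `tailSum a K = ∑_{i ≥ K} a^↓_i` (1-based indices `i`, comparison `K ≤ (i : ℝ)`,
equivalently `i ≥ ⌈K⌉`). -/
def tailSum {α : Type*} [Fintype α] (a : α → ℝ) (K : ℝ) : ℝ :=
  ∑ i ∈ Finset.univ.filter (fun i : Fin (Fintype.card α) => K ≤ ((i : ℕ) + 1 : ℝ)),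
    descSorted a i

/-- `a` majorises `b` (written `a ≻ b`): every partial sum of the non-increasingly sorted
`a` dominates the corresponding partial sum of sorted `b` (shorter vectors padded with zeros). -/
def Maj {α β : Type*} [Fintype α] [Fintype β] (a : α → ℝ) (b : β → ℝ) : Prop :=
  ∀ j : ℕ, headSum b (j : ℝ) ≤ headSum a (j : ℝ)

/-- `a ≻_ε b`: approximate majorisation (from above) with total variation error:
there is a probability distribution `b̃` with `a ≻ b̃` and `δ(b, b̃) ≤ ε`. -/
def ApproxMajTV {α β : Type*} [Fintype α] [Fintype β] (a : α → ℝ) (b : β → ℝ) (ε : ℝ) : Prop :=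
  ∃ bt : β → ℝ, IsProbDist bt ∧ Maj a bt ∧ tvd b bt ≤ ε

/-- `a ≺_ε b`: approximate majorisation (from below) with total variation error:
there is a probability distribution `b̃` with `a ≺ b̃` and `δ(b, b̃) ≤ ε`. -/
def ApproxSubMajTV {α β : Type*} [Fintype α] [Fintype β] (a : α → ℝ) (b : β → ℝ) (ε : ℝ) : Prop :=
  ∃ bt : β → ℝ, IsProbDist bt ∧ Maj bt a ∧ tvd b bt ≤ ε

/-- A moderate sequence: `t n → 0` and `√n · t n → +∞`. -/
def ModerateSeq (t : ℕ → ℝ) : Prop :=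
  Tendsto t atTop (𝓝 0) ∧ Tendsto (fun n : ℕ => Real.sqrt (n : ℝ) * t n) atTop atTop

/-- The uniform distribution on `Fin d`. -/
def unif (d : ℕ) : Fin d → ℝ := fun _ => 1 / (d : ℝ)

/-- The embedding map `Γ` associated with `γ_i = c_i / N`: for each `i` it produces
`c_i` entries equal to `a_i / c_i`. -/
def embed {d : ℕ} (c : Fin d → ℕ) (a : Fin d → ℝ) : (Σ i : Fin d, Fin (c i)) → ℝ :=
  fun x => a x.1 / (c x.1 : ℝ)

/-- Cut-and-pile modification of the sorted version of `a`, with cut at `K`: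
the first entry absorbs the total mass of entries at (1-based) positions `≥ K`,
entries at positions `1 < i < K` are unchanged, and entries at positions `≥ K` are set to 0. -/
def cutAndPile {α : Type*} [Fintype α] (a : α → ℝ) (K : ℝ) : Fin (Fintype.card α) → ℝ :=
  fun i =>
    if (i : ℕ) = 0 then descSorted a i + tailSum a K
    else if ((i : ℕ) + 1 : ℝ) < K then descSorted a i else 0


/-! ### Majorisation and hockey-stick sums -/

theorem descSorted_antitone {α : Type*} [Fintype α] (a : α → ℝ) : Antitone (descSorted a) := by
  intro i j hij
  have h := Tuple.monotone_sort (fun j => -a ((Fintype.equivFin α).symm j)) hij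
  exact neg_le_neg_iff.mp h

theorem sum_descSorted {α : Type*} [Fintype α] (a : α → ℝ) (g : ℝ → ℝ) :
    ∑ i, g (descSorted a i) = ∑ x, g (a x) :=
  Equiv.sum_comp ((Tuple.sort (fun j => -a ((Fintype.equivFin α).symm j))).trans
    (Fintype.equivFin α).symm) (fun x => g (a x))

theorem headSum_natCast {α : Type*} [Fintype α] (a : α → ℝ) (j : ℕ) :
    headSum a (j : ℝ) =
      ∑ i ∈ univ.filter (fun i : Fin (Fintype.card α) => (i : ℕ) < j), descSorted a i := by
  unfold headSum
  congr 1
  ext i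
  simp only [mem_filter, mem_univ, true_and]
  exact_mod_cast Nat.succ_le_iff

theorem headSum_le {α : Type*} [Fintype α] (a : α → ℝ) {τ : ℝ} (hτ : 0 ≤ τ) (j : ℕ) :
    headSum a (j : ℝ) ≤ ∑ x, max (a x - τ) 0 + j * τ := by
  rw [headSum_natCast, ← sum_descSorted a (fun y => max (y - τ) 0)]
  have hcard : ((univ.filter (fun i : Fin (Fintype.card α) => (i : ℕ) < j)).card : ℝ) ≤ j := by
    rw [Fin.card_filter_val_lt]
    exact_mod_cast min_le_right _ _
  calc ∑ i ∈ univ.filter (fun i : Fin (Fintype.card α) => (i : ℕ) < j), descSorted a i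
      ≤ ∑ i ∈ univ.filter (fun i : Fin (Fintype.card α) => (i : ℕ) < j),
          (max (descSorted a i - τ) 0 + τ) :=
        sum_le_sum fun i _ => by linarith [le_max_left (descSorted a i - τ) 0]
    _ = ∑ i ∈ univ.filter (fun i : Fin (Fintype.card α) => (i : ℕ) < j),
          max (descSorted a i - τ) 0 +
          (univ.filter (fun i : Fin (Fintype.card α) => (i : ℕ) < j)).card * τ := by
        rw [sum_add_distrib, sum_const, nsmul_eq_mul]
    _ ≤ _ := by
        gcongr
        exact filter_subset _ _

theorem exists_headSum_ge {α : Type*} [Fintype α] (a : α → ℝ) (ha : ∀ x, 0 ≤ a x) (j : ℕ) :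
    ∃ τ, 0 ≤ τ ∧ ∑ x, max (a x - τ) 0 + j * τ ≤ headSum a (j : ℝ) := by
  rcases lt_or_ge j (Fintype.card α) with hj | hj
  · refine ⟨descSorted a ⟨j, hj⟩, ha _, ?_⟩
    set τ := descSorted a ⟨j, hj⟩ with hτ
    rw [headSum_natCast, ← sum_descSorted a (fun y => max (y - τ) 0)]
    have hcard : ((univ.filter (fun i : Fin (Fintype.card α) => (i : ℕ) < j)).card : ℝ) = j := by
      rw [Fin.card_filter_val_lt, min_eq_right hj.le]
    have hsplit : ∑ i, max (descSorted a i - τ) 0 =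
        ∑ i ∈ univ.filter (fun i : Fin (Fintype.card α) => (i : ℕ) < j),
          (descSorted a i - τ) := by
      rw [sum_filter]
      refine sum_congr rfl fun i _ => ?_
      split_ifs with h
      · exact max_eq_left (sub_nonneg.mpr (descSorted_antitone a (Fin.mk_le_mk.mpr h.le)))
      · refine max_eq_right (sub_nonpos.mpr (descSorted_antitone a ?_))
        exact Fin.mk_le_of_le_val (not_lt.mp h)
    rw [hsplit, sum_sub_distrib, sum_const, nsmul_eq_mul, hcard]
    linarith
  · refine ⟨0, le_rfl, ?_⟩
    rw [headSum_natCast, filter_true_of_mem fun i _ => i.2.trans_le hj,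
      sum_descSorted a (fun y => y)]
    simp [ha]

/-- Hockey-stick sum of `a`, with the threshold `r` measured relative to the uniform
distribution. -/
def hockey {α : Type*} [Fintype α] (a : α → ℝ) (r : ℝ) : ℝ :=
  ∑ x, max (a x - r / (Fintype.card α : ℝ)) 0

theorem maj_of_hockey_le {α β : Type*} [Fintype α] [Fintype β] [Nonempty α] {a : α → ℝ}
    {b : β → ℝ}
    (hcard : Fintype.card α = Fintype.card β) (ha : ∀ x, 0 ≤ a x)
    (h : ∀ r, 0 ≤ r → hockey b r ≤ hockey a r) : Maj a b := by
  intro j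
  obtain ⟨τ, hτ, hj⟩ := exists_headSum_ge a ha j
  have hpos : (0 : ℝ) < Fintype.card α := by exact_mod_cast Fintype.card_pos
  have h1 := h (τ * Fintype.card α) (by positivity)
  unfold hockey at h1
  rw [← hcard, mul_div_cancel_right₀ _ hpos.ne'] at h1
  linarith [headSum_le b hτ j]

theorem sum_le_hockey_of_maj {α β : Type*} [Fintype α] [Fintype β] {a : α → ℝ} {b : β → ℝ}
    (hb : ∀ x, 0 ≤ b x) (h : Maj a b) (T : Finset β) {r : ℝ} (hr : 0 ≤ r) :
    ∑ x ∈ T, b x ≤ hockey a r + T.card * (r / Fintype.card α) := by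
  obtain ⟨τ, hτ, hj⟩ := exists_headSum_ge b hb T.card
  have h1 := headSum_le a (div_nonneg hr (Nat.cast_nonneg (Fintype.card α))) T.card
  have h2 : ∑ x ∈ T, b x ≤ ∑ x, max (b x - τ) 0 + T.card * τ :=
    calc ∑ x ∈ T, b x ≤ ∑ x ∈ T, (max (b x - τ) 0 + τ) :=
          sum_le_sum fun x _ => by linarith [le_max_left (b x - τ) 0]
      _ = ∑ x ∈ T, max (b x - τ) 0 + T.card * τ := by
          rw [sum_add_distrib, sum_const, nsmul_eq_mul]
      _ ≤ _ := by
          gcongr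
          exact subset_univ T
  exact (h2.trans hj).trans ((h T.card).trans h1)

theorem hockey_tensor_uniform {α β : Type*} [Fintype α] [Fintype β] [Nonempty β] (a : α → ℝ)
    {u : β → ℝ} (hu : IsUniform u) (r : ℝ) : hockey (tensor a u) r = hockey a r := by
  have hpos : (0 : ℝ) < Fintype.card β := by exact_mod_cast Fintype.card_pos
  unfold hockey
  rw [Fintype.sum_prod_type]
  refine sum_congr rfl fun x _ => ?_
  have h1 : ∀ y, max (tensor a u (x, y) - r / (Fintype.card (α × β) : ℝ)) 0 =
      max (a x - r / Fintype.card α) 0 / Fintype.card β := by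
    intro y
    rw [Fintype.card_prod, tensor, hu, ← max_div_div_right hpos.le, zero_div]
    push_cast
    congr 1
    rw [sub_div, div_div, mul_one_div]
  simp_rw [h1]
  rw [sum_const, card_univ, nsmul_eq_mul, mul_div_cancel₀ _ hpos.ne']

/-- Mass of the outcomes whose probability exceeds `r` times the uniform one. -/
def upperMass {α : Type*} [Fintype α] (a : α → ℝ) (r : ℝ) : ℝ :=
  ∑ x ∈ univ.filter (fun x => r < Fintype.card α * a x), a x

section Masses

variable {α : Type*} [Fintype α] {a : α → ℝ}

theorem upperMass_nonneg (ha : IsProbDist a) (r : ℝ) : 0 ≤ upperMass a r :=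
  sum_nonneg fun x _ => ha.1 x

theorem upperMass_add_compl (ha : IsProbDist a) (r : ℝ) :
    upperMass a r + ∑ x ∈ univ.filter (fun x => ¬ r < Fintype.card α * a x), a x = 1 := by
  rw [upperMass, sum_filter_add_sum_filter_not, ha.2]

theorem one_sub_upperMass (ha : IsProbDist a) (r : ℝ) :
    1 - upperMass a r = ∑ x ∈ univ.filter (fun x => ¬ r < Fintype.card α * a x), a x := by
  linarith [upperMass_add_compl ha r]

theorem card_filter_lt_mul_le (ha : IsProbDist a) (r : ℝ) :
    ((univ.filter (fun x => r < Fintype.card α * a x)).card : ℝ) * r ≤ Fintype.card α := by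
  calc ((univ.filter (fun x => r < Fintype.card α * a x)).card : ℝ) * r
      = ∑ x ∈ univ.filter (fun x => r < Fintype.card α * a x), r := by
        rw [sum_const, nsmul_eq_mul]
    _ ≤ ∑ x ∈ univ.filter (fun x => r < Fintype.card α * a x), Fintype.card α * a x :=
        sum_le_sum fun x hx => (mem_filter.mp hx).2.le
    _ ≤ ∑ x, Fintype.card α * a x :=
        sum_le_sum_of_subset_of_nonneg (filter_subset _ _) fun x _ _ =>
          mul_nonneg (Nat.cast_nonneg _) (ha.1 x)
    _ = Fintype.card α := by rw [← mul_sum, ha.2, mul_one]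

theorem hockey_le_upperMass [Nonempty α] (ha : IsProbDist a) {r : ℝ} (hr : 0 ≤ r) :
    hockey a r ≤ upperMass a r := by
  have hpos : (0 : ℝ) < Fintype.card α := by exact_mod_cast Fintype.card_pos
  unfold hockey upperMass
  rw [sum_filter]
  refine sum_le_sum fun x _ => ?_
  split_ifs with h
  · exact max_le (by linarith [div_nonneg hr hpos.le]) (ha.1 x)
  · refine max_le (sub_nonpos.mpr ?_) le_rfl
    rw [le_div_iff₀' hpos]
    exact not_lt.mp h

theorem half_upperMass_le_hockey [Nonempty α] (r : ℝ) :
    1 / 2 * upperMass a (2 * r) ≤ hockey a r := by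
  have hpos : (0 : ℝ) < Fintype.card α := by exact_mod_cast Fintype.card_pos
  unfold hockey upperMass
  rw [sum_filter, mul_sum]
  refine sum_le_sum fun x _ => ?_
  split_ifs with h
  · refine le_trans ?_ (le_max_left _ _)
    have : r / Fintype.card α < a x / 2 := by
      rw [div_lt_iff₀ hpos]
      linarith
    linarith
  · simp

theorem upperMass_sub_le_hockey [Nonempty α] (ha : IsProbDist a) {r r' : ℝ} (hr : 0 ≤ r) (hr' : 0 < r') :
    upperMass a r' - r / r' ≤ hockey a r := by
  have hpos : (0 : ℝ) < Fintype.card α := by exact_mod_cast Fintype.card_pos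
  set T := univ.filter (fun x => r' < Fintype.card α * a x) with hT
  have hcard : (T.card : ℝ) * (r / Fintype.card α) ≤ r / r' := by
    have h := card_filter_lt_mul_le ha r'
    rw [← hT, ← le_div_iff₀ hr'] at h
    calc (T.card : ℝ) * (r / Fintype.card α)
        ≤ Fintype.card α / r' * (r / Fintype.card α) := by gcongr
      _ = r / r' := by field_simp
  have h1 : ∑ x ∈ T, (a x - r / Fintype.card α) ≤ hockey a r :=
    (sum_le_sum fun x _ => le_max_left _ _).trans
      (sum_le_sum_of_subset_of_nonneg (subset_univ T) fun x _ _ => le_max_right _ _)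
  rw [sum_sub_distrib, sum_const, nsmul_eq_mul] at h1
  have h2 : upperMass a r' = ∑ x ∈ T, a x := rfl
  linarith

theorem hockey_eq_one_sub (ha : IsProbDist a) (r : ℝ) :
    hockey a r = 1 - ∑ x, min (a x) (r / Fintype.card α) := by
  unfold hockey
  rw [← ha.2, ← sum_sub_distrib]
  refine sum_congr rfl fun x _ => ?_
  rcases le_total (a x) (r / Fintype.card α) with h | h
  · rw [min_eq_left h, max_eq_right (by linarith), sub_self]
  · rw [min_eq_right h, max_eq_left (by linarith)]

end Masses

/-! ### Tensor powers, marginals and fidelity -/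

theorem IsProbDist.tpow {α : Type*} [Fintype α] {a : α → ℝ} (ha : IsProbDist a) (n : ℕ) :
    IsProbDist (tpow a n) :=
  ⟨fun _ => prod_nonneg fun _ _ => ha.1 _, by
    unfold _root_.tpow
    rw [← Fintype.sum_pow, ha.2, one_pow]⟩

theorem IsProbDist.tensor {α β : Type*} [Fintype α] [Fintype β] {a : α → ℝ} {b : β → ℝ}
    (ha : IsProbDist a) (hb : IsProbDist b) : IsProbDist (tensor a b) :=
  ⟨fun _ => mul_nonneg (ha.1 _) (hb.1 _), by
    unfold _root_.tensor
    rw [Fintype.sum_prod_type, ← Fintype.sum_mul_sum, ha.2, hb.2, one_mul]⟩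

theorem IsUniform.isProbDist {α : Type*} [Fintype α] [Nonempty α] {a : α → ℝ}
    (ha : IsUniform a) : IsProbDist a := by
  refine ⟨fun i => by rw [ha]; positivity, ?_⟩
  simp_rw [ha _]
  simp

theorem isUniform_unif (N : ℕ) : IsUniform (unif N) := fun _ => by simp [unif]

theorem IsUniform.tpow {α : Type*} [Fintype α] {a : α → ℝ} (ha : IsUniform a) (n : ℕ) :
    IsUniform (tpow a n) := by
  intro f
  simp [_root_.tpow, ha _]

/-- Summing a product weight over the event that the first `m` coordinates lie in `S`. -/
theorem sum_filter_initial {α β : Type*} [Fintype α] [Fintype β] (a : α → ℝ) (u : β → ℝ)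
    (m k : ℕ) (S : (Fin m → α) → Prop) [DecidablePred S] :
    ∑ x ∈ (univ : Finset ((Fin (m + k) → α) × β)).filter
        (fun x => S fun i => x.1 (Fin.castAdd k i)), tensor (tpow a (m + k)) u x =
      (∑ g ∈ univ.filter S, tpow a m g) * (∑ i, a i) ^ k * ∑ y, u y := by
  have happ : ∀ (g : Fin m → α) (h : Fin k → α),
      (Fin.appendEquiv m k) (g, h) = Fin.append g h := fun _ _ => rfl
  rw [sum_filter, Fintype.sum_prod_type, ← Equiv.sum_comp (Fin.appendEquiv m k),
    Fintype.sum_prod_type, sum_filter, Fintype.sum_pow, sum_mul, sum_mul]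
  refine sum_congr rfl fun g _ => ?_
  rw [mul_assoc, sum_mul, mul_sum]
  refine sum_congr rfl fun h _ => ?_
  rw [mul_sum, mul_sum]
  refine sum_congr rfl fun y _ => ?_
  simp only [happ, Fin.append_left, tensor, tpow, Fin.prod_univ_add, Fin.append_right]
  split_ifs <;> ring

theorem sum_sqrt_mul_le_one {α : Type*} [Fintype α] {a b : α → ℝ} (ha : IsProbDist a)
    (hb : IsProbDist b) : ∑ x, √(a x * b x) ≤ 1 := by
  have h := Real.sum_sqrt_mul_sqrt_le univ ha.1 hb.1
  simp_rw [← Real.sqrt_mul (ha.1 _)] at h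
  simpa [ha.2, hb.2] using h

theorem fid_comm {α : Type*} [Fintype α] (a b : α → ℝ) : fid a b = fid b a := by
  simp only [fid, mul_comm]

/-- The infidelity controls the probabilities of every event multiplicatively. -/
theorem sum_le_of_infidelity {α : Type*} [Fintype α] {a b : α → ℝ} (ha : IsProbDist a)
    (hb : IsProbDist b) {e : ℝ} (h : 1 - fid a b ≤ e) (T : Finset α) :
    ∑ x ∈ T, a x ≤ 2 * ∑ x ∈ T, b x + 4 * e := by
  set f := ∑ x, √(a x * b x) with hf
  have hf0 : 0 ≤ f := sum_nonneg fun _ _ => Real.sqrt_nonneg _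
  have hf1 : f ≤ 1 := sum_sqrt_mul_le_one ha hb
  have hfid : 1 - f ^ 2 ≤ e := h
  have hsq : ∑ x, (√(a x) - √(b x)) ^ 2 = 2 - 2 * f := by
    have h1 : ∀ x, (√(a x) - √(b x)) ^ 2 = a x + b x - 2 * √(a x * b x) := by
      intro x
      rw [Real.sqrt_mul (ha.1 x), sub_sq, Real.sq_sqrt (ha.1 x), Real.sq_sqrt (hb.1 x)]
      ring
    simp_rw [h1]
    rw [sum_sub_distrib, sum_add_distrib, ha.2, hb.2, ← mul_sum]
    ring
  have hpt : ∀ x, a x ≤ 2 * b x + 2 * (√(a x) - √(b x)) ^ 2 := by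
    intro x
    have h1 := Real.sq_sqrt (ha.1 x)
    have h2 := Real.sq_sqrt (hb.1 x)
    nlinarith [sq_nonneg (√(a x) - 2 * √(b x))]
  calc ∑ x ∈ T, a x ≤ ∑ x ∈ T, (2 * b x + 2 * (√(a x) - √(b x)) ^ 2) :=
        sum_le_sum fun x _ => hpt x
    _ = 2 * ∑ x ∈ T, b x + 2 * ∑ x ∈ T, (√(a x) - √(b x)) ^ 2 := by
        rw [sum_add_distrib, mul_sum, mul_sum]
    _ ≤ 2 * ∑ x ∈ T, b x + 2 * ∑ x, (√(a x) - √(b x)) ^ 2 := by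
        gcongr
        exact subset_univ T
    _ ≤ 2 * ∑ x ∈ T, b x + 4 * e := by
        rw [hsq]
        nlinarith

theorem fid_tensor {α β : Type*} [Fintype α] [Fintype β] {a b : α → ℝ} {u : β → ℝ}
    (hu : IsProbDist u) : fid (tensor a u) (tensor b u) = fid a b := by
  unfold fid
  congr 1
  rw [Fintype.sum_prod_type]
  refine sum_congr rfl fun x _ => ?_
  have h : ∀ y, √(tensor a u (x, y) * tensor b u (x, y)) = √(a x * b x) * u y := by
    intro y
    rw [tensor, tensor, show a x * u y * (b x * u y) = u y ^ 2 * (a x * b x) by ring,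
      Real.sqrt_mul (sq_nonneg _), Real.sqrt_sq (hu.1 y), mul_comm]
  simp_rw [h]
  rw [← mul_sum, hu.2, mul_one]

/-- The conversion `(A^{⊗n} ⊗ η^{⊗m}) → (B^{⊗m} ⊗ η^{⊗n})` is possible with infidelity at
most `e`. -/
def Convertible {α β : Type*} [Fintype α] [Fintype β] (A : α → ℝ) (B : β → ℝ) (N n m : ℕ)
    (e : ℝ) : Prop :=
  ∃ Qt : (Fin m → β) × (Fin n → Fin N) → ℝ, IsProbDist Qt ∧
    Maj (tensor (tpow A n) (tpow (unif N) m)) Qt ∧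
    1 - fid (tensor (tpow B m) (tpow (unif N) n)) Qt ≤ e

section Convertible

variable {α β : Type*} [Fintype α] [Fintype β] [Nonempty α] {A : α → ℝ}
  {B : β → ℝ} {N : ℕ} [NeZero N]

/-- Testing the output on its first `m` systems bounds the tails of `B^{⊗m}` in terms of those
of `A^{⊗n}`. -/
theorem Convertible.upperMass_le (hA : IsProbDist A) (hB : IsProbDist B)
    (hα : Fintype.card α = N) (hβ : Fintype.card β = N) {n m M : ℕ} (hm : m ≤ M) {e : ℝ}
    (h : Convertible A B N n M e) {r r' : ℝ} (hr : 0 ≤ r) (hr' : 0 < r') :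
    upperMass (tpow B m) r' ≤ 2 * (upperMass (tpow A n) r + r / r') + 4 * e ∧
    1 - upperMass (tpow A n) r - r / r' ≤ 2 * (1 - upperMass (tpow B m) r') + 4 * e := by
  obtain ⟨k, rfl⟩ := Nat.exists_eq_add_of_le hm
  obtain ⟨Qt, hQ, hmaj, hfid⟩ := h
  have hN : (0 : ℝ) < N := by exact_mod_cast Nat.pos_of_ne_zero (NeZero.ne N)
  have hun := ((isUniform_unif N).tpow n).isProbDist
  set S : (Fin m → β) → Prop := fun g => r' < Fintype.card (Fin m → β) * tpow B m g with hS
  set T := (univ : Finset ((Fin (m + k) → β) × (Fin n → Fin N))).filter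
    (fun x => S fun i => x.1 (Fin.castAdd k i)) with hT
  have hBm := hB.tpow m
  have hbT : ∑ x ∈ T, tensor (tpow B (m + k)) (tpow (unif N) n) x = upperMass (tpow B m) r' := by
    have h1 := sum_filter_initial B (tpow (unif N) n) m k S
    rw [hB.2, hun.2, one_pow, mul_one, mul_one] at h1
    exact h1
  have hcardT : (T.card : ℝ) = ((univ.filter S).card : ℝ) * (N : ℝ) ^ k * (N : ℝ) ^ n := by
    have h1 := sum_filter_initial (fun _ : β => (1 : ℝ)) (fun _ : Fin n → Fin N => (1 : ℝ)) m k S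
    simpa [tensor, tpow, hβ] using h1
  have hcard : (T.card : ℝ) *
      (r / Fintype.card ((Fin n → α) × (Fin (m + k) → Fin N))) ≤ r / r' := by
    have h1 := card_filter_lt_mul_le hBm r'
    rw [← le_div_iff₀ hr'] at h1
    have h2 : (Fintype.card (Fin m → β) : ℝ) = (N : ℝ) ^ m := by simp [hβ]
    have h3 : (Fintype.card ((Fin n → α) × (Fin (m + k) → Fin N)) : ℝ) =
        (N : ℝ) ^ n * (N : ℝ) ^ (m + k) := by simp [hα]
    rw [h3, hcardT]
    calc _ ≤ (Fintype.card (Fin m → β) : ℝ) / r' * (N : ℝ) ^ k * (N : ℝ) ^ n *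
          (r / ((N : ℝ) ^ n * (N : ℝ) ^ (m + k))) := by
          gcongr
      _ = r / r' := by
          rw [h2, pow_add]
          field_simp
  have hQT : ∑ x ∈ T, Qt x ≤ upperMass (tpow A n) r + r / r' := by
    have h1 := sum_le_hockey_of_maj hQ.1 hmaj T hr
    rw [hockey_tensor_uniform _ ((isUniform_unif N).tpow (m + k))] at h1
    linarith [hockey_le_upperMass (hA.tpow n) hr]
  have hbprob := (hB.tpow (m + k)).tensor hun
  classical
  have h1 := sum_le_of_infidelity hbprob hQ hfid T
  have h2 := sum_le_of_infidelity hQ hbprob (fid_comm _ Qt ▸ hfid) Tᶜ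
  have h3 := sum_add_sum_compl T Qt
  have h4 := sum_add_sum_compl T (tensor (tpow B (m + k)) (tpow (unif N) n))
  rw [hQ.2] at h3
  rw [hbprob.2, hbT] at h4
  rw [hbT] at h1
  constructor <;> linarith

theorem convertible_of_hockey_le (hA : IsProbDist A)
    (hα : Fintype.card α = N) (hβ : Fintype.card β = N) {n m : ℕ} {e : ℝ}
    {b : (Fin m → β) → ℝ} (hb : IsProbDist b)
    (h : ∀ r, 0 ≤ r → hockey b r ≤ hockey (tpow A n) r) (hfid : 1 - fid (tpow B m) b ≤ e) :
    Convertible A B N n m e := by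
  have hun := ((isUniform_unif N).tpow n).isProbDist
  have hum := ((isUniform_unif N).tpow m).isProbDist
  refine ⟨tensor b (tpow (unif N) n), hb.tensor hun, maj_of_hockey_le ?_ ?_ ?_, ?_⟩
  · simp [hα, hβ, mul_comm]
  · exact ((hA.tpow n).tensor hum).1
  · intro r hr
    rw [hockey_tensor_uniform _ ((isUniform_unif N).tpow n),
      hockey_tensor_uniform _ ((isUniform_unif N).tpow m)]
    exact h r hr
  · rwa [fid_tensor hun]

end Convertible

/-! ### Cutting the head and lifting the tail of a distribution -/

theorem exists_hockey_le_of_upperMass {α β : Type*} [Fintype α] [Fintype β] [Nonempty α]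
    [Nonempty β] {A : α → ℝ} {B : β → ℝ} (hA : IsProbDist A) (hB : IsProbDist B)
    {δ r₁ r₂ : ℝ} (hδ : 0 < δ) (hδ' : δ ≤ 1 / 2) (hr₂ : 1 ≤ r₂)
    (hhead : upperMass B (r₂ / 2) ≤ δ)
    (htail : ∃ r', 0 < r' ∧ 1 - upperMass A r' + r₁ / r' ≤ δ)
    (hmid : ∀ r, r₁ ≤ r → r ≤ r₂ →
      (2 * δ ≤ r ∧ upperMass B (r / 2) ≤ 1 / 2 * upperMass A (2 * r)) ∨
      (r ≤ r₂ / 2 ∧ ∃ r', 0 < r' ∧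
        1 - upperMass A r' + r / r' ≤ 1 / 2 * (1 - upperMass B r))) :
    ∃ b : β → ℝ, IsProbDist b ∧ (∀ r, 0 ≤ r → hockey b r ≤ hockey A r) ∧
      1 - fid B b ≤ 2 * δ := by
  set c : ℝ := (Fintype.card β : ℝ) with hc
  have hcpos : 0 < c := by
    rw [hc]
    exact_mod_cast Fintype.card_pos
  set U := upperMass B (r₂ / 2) with hU
  have hU0 : 0 ≤ U := upperMass_nonneg hB _
  have hUpos : 0 < 1 - U := by linarith
  set κ := (1 - δ) / (1 - U) with hκ
  have hκ1 : κ ≤ 1 := by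
    rw [hκ, div_le_one hUpos]
    linarith
  have hκ2 : 1 / 2 ≤ κ := by
    rw [hκ, le_div_iff₀ hUpos]
    linarith
  set g : β → ℝ := fun x => if r₂ / 2 < c * B x then 0 else κ * B x with hg
  set b : β → ℝ := fun x => g x + δ / c with hb
  have hgsum : ∑ x, g x = 1 - δ := by
    have h2 : ∑ x, g x = κ * ∑ x ∈ univ.filter (fun x => ¬ r₂ / 2 < c * B x), B x := by
      rw [mul_sum, sum_filter]
      refine sum_congr rfl fun x _ => ?_
      simp only [hg, ite_not]
    rw [h2, ← one_sub_upperMass hB, hκ, div_mul_cancel₀ _ hUpos.ne']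
  have hg0 : ∀ x, 0 ≤ g x := by
    intro x
    simp only [hg]
    split_ifs
    · exact le_rfl
    · exact mul_nonneg (by linarith) (hB.1 x)
  have hgB : ∀ x, g x ≤ B x := by
    intro x
    simp only [hg]
    split_ifs
    · exact hB.1 x
    · nlinarith [hB.1 x]
  have hδc : 0 < δ / c := div_pos hδ hcpos
  have hbprob : IsProbDist b := by
    refine ⟨fun x => add_nonneg (hg0 x) hδc.le, ?_⟩
    simp only [hb]
    rw [sum_add_distrib, hgsum, sum_const, card_univ, nsmul_eq_mul, ← hc,
      mul_div_cancel₀ _ hcpos.ne']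
    ring
  refine ⟨b, hbprob, ?_, ?_⟩
  · intro r hr
    rcases lt_or_ge r₂ r with hr2 | hr2
    · have h0 : hockey b r = 0 := by
        refine sum_eq_zero fun x _ => max_eq_right (sub_nonpos.mpr ?_)
        have h1 : g x ≤ r₂ / 2 / c := by
          simp only [hg]
          split_ifs with h
          · positivity
          · rw [le_div_iff₀ hcpos]
            nlinarith [hB.1 x]
        calc b x ≤ r₂ / 2 / c + δ / c := by
              simp only [hb]
              linarith
          _ = (r₂ / 2 + δ) / c := by ring
          _ ≤ r / c := by
              gcongr
              linarith
      rw [h0]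
      exact sum_nonneg fun x _ => le_max_right _ _
    rcases lt_or_ge r r₁ with hr1 | hr1
    · obtain ⟨r', hr', hA'⟩ := htail
      have h1 : min δ r ≤ ∑ x, min (b x) (r / c) := by
        have h2 : ∀ x, min δ r / c ≤ min (b x) (r / c) := by
          intro x
          refine le_min ?_ ?_
          · refine le_trans ?_ (le_add_of_nonneg_left (hg0 x))
            gcongr
            exact min_le_left _ _
          · gcongr
            exact min_le_right _ _
        calc min δ r = ∑ _x : β, min δ r / c := by
              rw [sum_const, card_univ, nsmul_eq_mul, ← hc, mul_div_cancel₀ _ hcpos.ne']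
          _ ≤ _ := sum_le_sum fun x _ => h2 x
      rw [hockey_eq_one_sub hbprob]
      rcases le_total δ r with hd | hd
      · rw [min_eq_left hd] at h1
        have h3 := upperMass_sub_le_hockey hA hr hr'
        have h4 : r / r' ≤ r₁ / r' := by gcongr
        linarith
      · rw [min_eq_right hd] at h1
        rw [hockey_eq_one_sub hA]
        have h3 : ∑ x, min (A x) (r / Fintype.card α) ≤ r := by
          have hpos : (0 : ℝ) < Fintype.card α := by exact_mod_cast Fintype.card_pos
          calc ∑ x, min (A x) (r / Fintype.card α) ≤ ∑ _x : α, r / Fintype.card α :=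
                sum_le_sum fun x _ => min_le_right _ _
            _ = r := by
                rw [sum_const, card_univ, nsmul_eq_mul, mul_div_cancel₀ _ hpos.ne']
        linarith
    rcases hmid r hr1 hr2 with ⟨hδr, h⟩ | ⟨hr3, r', hr', h⟩
    · refine le_trans (le_trans ?_ h) (half_upperMass_le_hockey r)
      unfold hockey upperMass
      rw [sum_filter]
      refine sum_le_sum fun x _ => ?_
      have h1 : δ / c ≤ r / 2 / c := by
        gcongr
        linarith
      have h2 : r / c = r / 2 / c + r / 2 / c := by ring
      have h3 := hgB x
      have h4 : 0 ≤ r / 2 / c := by positivity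
      rw [← hc]
      simp only [hb]
      split_ifs with h5
      · exact max_le (by linarith) (hB.1 x)
      · refine max_le ?_ le_rfl
        have h6 : B x ≤ r / 2 / c := by
          rw [le_div_iff₀' hcpos]
          exact not_lt.mp h5
        linarith
    · rw [hockey_eq_one_sub hbprob]
      have h1 := upperMass_sub_le_hockey hA hr hr'
      have h2 : 1 / 2 * (1 - upperMass B r) ≤ ∑ x, min (b x) (r / c) := by
        rw [one_sub_upperMass hB, mul_sum, sum_filter]
        refine sum_le_sum fun x _ => ?_
        have hBx := hB.1 x
        split_ifs with h5
        · exact le_min (add_nonneg (hg0 x) hδc.le) (by positivity)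
        · have h6 := not_lt.mp h5
          refine le_min ?_ ?_
          · have h7 : ¬ r₂ / 2 < c * B x := not_lt.mpr (h6.trans hr3)
            simp only [hb, hg, if_neg h7]
            nlinarith
          · rw [le_div_iff₀' hcpos]
            nlinarith
      linarith
  · have h1 : √κ * (1 - U) ≤ ∑ x, √(B x * b x) := by
      rw [hU, one_sub_upperMass hB, mul_sum, sum_filter]
      refine sum_le_sum fun x _ => ?_
      split_ifs with h5
      · exact Real.sqrt_nonneg _
      · have h6 : 0 ≤ B x * (δ / c) := mul_nonneg (hB.1 x) hδc.le
        calc √κ * B x = √κ * √(B x ^ 2) := by rw [Real.sqrt_sq (hB.1 x)]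
          _ = √(κ * B x ^ 2) := (Real.sqrt_mul (by linarith) _).symm
          _ ≤ √(B x * b x) := by
              apply Real.sqrt_le_sqrt
              simp only [hb, hg, hc, if_neg h5]
              rw [← hc]
              nlinarith
    have h2 : (√κ * (1 - U)) ^ 2 ≤ fid B b :=
      pow_le_pow_left₀ (by positivity) h1 2
    rw [mul_pow, Real.sq_sqrt (by linarith), hκ, sq, ← mul_assoc,
      div_mul_cancel₀ _ hUpos.ne'] at h2
    nlinarith

/-! ### A Gaussian Gärtner–Ellis theorem for finite sums -/

theorem eventually_mul_exp_le {s : ℕ → ℝ} (hs : Tendsto s atTop atTop) (C : ℝ) {x y : ℝ}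
    (hxy : x < y) : ∀ᶠ n in atTop, C * exp (s n * x) ≤ exp (s n * y) := by
  have h1 : Tendsto (fun n => exp (s n * (y - x))) atTop atTop :=
    Real.tendsto_exp_atTop.comp (hs.atTop_mul_const (sub_pos.mpr hxy))
  filter_upwards [h1.eventually_ge_atTop C] with n hn
  calc C * exp (s n * x) ≤ exp (s n * (y - x)) * exp (s n * x) := by gcongr
    _ = exp (s n * y) := by rw [← Real.exp_add]; ring_nf

/-- Gaussian rate function with variance parameter `σ`. -/
def gaussRate (σ z : ℝ) : ℝ := max z 0 ^ 2 / (2 * σ)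

theorem continuous_gaussRate (σ : ℝ) : Continuous (gaussRate σ) := by
  unfold gaussRate
  fun_prop

section GartnerEllis

variable {α : ℕ → Type*} [∀ n, Fintype (α n)] {W Z : ∀ n, α n → ℝ} {s : ℕ → ℝ} {σ : ℝ}

theorem eventually_sum_filter_lt_le (hW : ∀ n, IsProbDist (W n)) (hs : Tendsto s atTop atTop)
    (hσ : 0 < σ)
    (hub : ∀ l c, l ^ 2 * σ / 2 < c →
      ∀ᶠ n in atTop, ∑ x, W n x * exp (s n * (l * Z n x)) ≤ exp (s n * c))
    {z c : ℝ} (hc : c < gaussRate σ z) :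
    ∀ᶠ n in atTop, ∑ x ∈ univ.filter (fun x => z < Z n x), W n x ≤ exp (-(s n * c)) := by
  rcases le_or_gt z 0 with hz | hz
  · rw [gaussRate, max_eq_right hz] at hc
    have hc0 : c < 0 := by simpa using hc
    filter_upwards [hs.eventually_ge_atTop 0] with n hn
    calc ∑ x ∈ univ.filter (fun x => z < Z n x), W n x ≤ ∑ x, W n x :=
          sum_le_sum_of_subset_of_nonneg (filter_subset _ _) fun x _ _ => (hW n).1 x
      _ = 1 := (hW n).2
      _ ≤ exp (-(s n * c)) := Real.one_le_exp (by nlinarith)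
  · rw [gaussRate, max_eq_left hz.le] at hc
    set l := z / σ with hl
    have hl0 : 0 < l := div_pos hz hσ
    have hval : l ^ 2 * σ / 2 < l * z - c := by
      have : l ^ 2 * σ / 2 = l * z - z ^ 2 / (2 * σ) := by
        rw [hl]
        field_simp
        ring
      linarith
    filter_upwards [hs.eventually_ge_atTop 0, hub l _ hval] with n hn hM
    have h1 : exp (s n * (l * z)) * ∑ x ∈ univ.filter (fun x => z < Z n x), W n x ≤
        ∑ x, W n x * exp (s n * (l * Z n x)) := by
      rw [mul_sum, sum_filter]
      refine sum_le_sum fun x _ => ?_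
      have hWx := (hW n).1 x
      split_ifs with h
      · rw [mul_comm]
        gcongr
      · positivity
    have h2 := h1.trans hM
    rw [← le_div_iff₀' (Real.exp_pos _), ← Real.exp_sub] at h2
    refine h2.trans_eq ?_
    congr 1
    ring

theorem eventually_le_sum_filter_lt_of_nonneg (hW : ∀ n, IsProbDist (W n))
    (hs : Tendsto s atTop atTop) (hσ : 0 < σ)
    (hub : ∀ l c, l ^ 2 * σ / 2 < c →
      ∀ᶠ n in atTop, ∑ x, W n x * exp (s n * (l * Z n x)) ≤ exp (s n * c))
    (hlb : ∀ l c, c < l ^ 2 * σ / 2 →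
      ∀ᶠ n in atTop, exp (s n * c) ≤ ∑ x, W n x * exp (s n * (l * Z n x)))
    {z c : ℝ} (hz : 0 ≤ z) (hc : z ^ 2 / (2 * σ) < c) :
    ∀ᶠ n in atTop, exp (-(s n * c)) ≤ ∑ x ∈ univ.filter (fun x => z < Z n x), W n x := by
  obtain ⟨κ, hκc, hκ⟩ : ∃ κ, ((z + κ) * (z + 3 * κ) + κ ^ 2 / 2) / (2 * σ) < c ∧ 0 < κ := by
    have hcont : Continuous fun κ : ℝ => ((z + κ) * (z + 3 * κ) + κ ^ 2 / 2) / (2 * σ) := by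
      fun_prop
    have h0 : ((z + 0) * (z + 3 * 0) + (0 : ℝ) ^ 2 / 2) / (2 * σ) < c := by
      convert hc using 2
      ring
    have h1 : ∀ᶠ κ in 𝓝[>] (0 : ℝ), ((z + κ) * (z + 3 * κ) + κ ^ 2 / 2) / (2 * σ) < c :=
      (hcont.continuousAt.eventually_lt_const h0).filter_mono nhdsWithin_le_nhds
    exact (h1.and self_mem_nhdsWithin).exists
  set l := (z + κ) / σ with hl
  set h := κ / σ with hh
  set G := κ ^ 2 / (2 * σ) with hG
  set L := l ^ 2 * σ / 2 with hL
  have hGpos : 0 < G := by positivity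
  have hl0 : 0 ≤ l := by positivity
  have hh0 : 0 ≤ h := by positivity
  have hminus : (l - h) ^ 2 * σ / 2 < L - 3 / 4 * G - h * z := by
    have : (l - h) ^ 2 * σ / 2 = L - G - h * z := by
      rw [hL, hG, hl, hh]
      field_simp
      ring
    linarith
  have hplus : (l + h) ^ 2 * σ / 2 < L - 3 / 4 * G + h * (z + 2 * κ) := by
    have : (l + h) ^ 2 * σ / 2 = L - G + h * (z + 2 * κ) := by
      rw [hL, hG, hl, hh]
      field_simp
      ring
    linarith
  have hfin : l * (z + 2 * κ) - c < L - G / 2 := by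
    have : L - G / 2 - l * (z + 2 * κ) =
        -(((z + κ) * (z + 3 * κ) + κ ^ 2 / 2) / (2 * σ)) := by
      rw [hL, hG, hl]
      field_simp
      ring
    linarith
  filter_upwards [hs.eventually_ge_atTop 0, hub _ _ hminus, hub _ _ hplus,
    hlb l (L - G / 4) (by linarith),
    eventually_mul_exp_le hs 3 (show L - 3 / 4 * G < L - G / 4 by linarith),
    eventually_mul_exp_le hs 3 (show l * (z + 2 * κ) - c < L - G / 4 by linarith)]
    with n hn hM1 hM2 hM hE1 hE2
  set T := ∑ x ∈ univ.filter (fun x => z < Z n x), W n x with hT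
  have hsplit : ∑ x, W n x * exp (s n * (l * Z n x)) ≤
      exp (s n * (h * z)) * ∑ x, W n x * exp (s n * ((l - h) * Z n x)) +
      exp (-(s n * (h * (z + 2 * κ)))) * ∑ x, W n x * exp (s n * ((l + h) * Z n x)) +
      exp (s n * (l * (z + 2 * κ))) * T := by
    rw [hT, sum_filter, mul_sum, mul_sum, mul_sum, ← sum_add_distrib, ← sum_add_distrib]
    refine sum_le_sum fun x _ => ?_
    have hWx := (hW n).1 x
    have e1 : exp (s n * (h * z)) * (W n x * exp (s n * ((l - h) * Z n x))) =
        W n x * exp (s n * (l * Z n x) + s n * h * (z - Z n x)) := by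
      rw [mul_left_comm, ← Real.exp_add]
      ring_nf
    have e2 : exp (-(s n * (h * (z + 2 * κ)))) * (W n x * exp (s n * ((l + h) * Z n x))) =
        W n x * exp (s n * (l * Z n x) + s n * h * (Z n x - (z + 2 * κ))) := by
      rw [mul_left_comm, ← Real.exp_add]
      ring_nf
    rw [e1, e2]
    have hsh : 0 ≤ s n * h := mul_nonneg hn hh0
    have p1 : 0 ≤ W n x * exp (s n * (l * Z n x) + s n * h * (z - Z n x)) := by positivity
    have p2 : 0 ≤ W n x * exp (s n * (l * Z n x) + s n * h * (Z n x - (z + 2 * κ))) := by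
      positivity
    split_ifs with hzx
    · have p3 : 0 ≤ exp (s n * (l * (z + 2 * κ))) * W n x := by positivity
      rcases le_or_gt (Z n x) (z + 2 * κ) with hx | hx
      · have : W n x * exp (s n * (l * Z n x)) ≤ exp (s n * (l * (z + 2 * κ))) * W n x := by
          rw [mul_comm]
          gcongr
        linarith
      · have : W n x * exp (s n * (l * Z n x)) ≤
            W n x * exp (s n * (l * Z n x) + s n * h * (Z n x - (z + 2 * κ))) := by
          gcongr
          linarith [mul_nonneg hsh (sub_nonneg.mpr hx.le)]
        linarith
    · have : W n x * exp (s n * (l * Z n x)) ≤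
          W n x * exp (s n * (l * Z n x) + s n * h * (z - Z n x)) := by
        gcongr
        linarith [mul_nonneg hsh (sub_nonneg.mpr (not_lt.mp hzx))]
      linarith
  have b1 : exp (s n * (h * z)) * ∑ x, W n x * exp (s n * ((l - h) * Z n x)) ≤
      exp (s n * (L - 3 / 4 * G)) := by
    calc _ ≤ exp (s n * (h * z)) * exp (s n * (L - 3 / 4 * G - h * z)) := by gcongr
      _ = _ := by
        rw [← Real.exp_add]
        ring_nf
  have b2 : exp (-(s n * (h * (z + 2 * κ)))) * ∑ x, W n x * exp (s n * ((l + h) * Z n x)) ≤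
      exp (s n * (L - 3 / 4 * G)) := by
    calc _ ≤ exp (-(s n * (h * (z + 2 * κ)))) *
          exp (s n * (L - 3 / 4 * G + h * (z + 2 * κ))) := by gcongr
      _ = _ := by
        rw [← Real.exp_add]
        ring_nf
  have hmain : exp (s n * (l * (z + 2 * κ) - c)) ≤ exp (s n * (l * (z + 2 * κ))) * T := by
    linarith
  have heq : exp (s n * (l * (z + 2 * κ) - c)) =
      exp (s n * (l * (z + 2 * κ))) * exp (-(s n * c)) := by
    rw [← Real.exp_add]
    ring_nf
  rw [heq] at hmain
  exact le_of_mul_le_mul_left hmain (Real.exp_pos _)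

theorem eventually_le_sum_filter_lt (hW : ∀ n, IsProbDist (W n))
    (hs : Tendsto s atTop atTop) (hσ : 0 < σ)
    (hub : ∀ l c, l ^ 2 * σ / 2 < c →
      ∀ᶠ n in atTop, ∑ x, W n x * exp (s n * (l * Z n x)) ≤ exp (s n * c))
    (hlb : ∀ l c, c < l ^ 2 * σ / 2 →
      ∀ᶠ n in atTop, exp (s n * c) ≤ ∑ x, W n x * exp (s n * (l * Z n x)))
    {z c : ℝ} (hc : gaussRate σ z < c) :
    ∀ᶠ n in atTop, exp (-(s n * c)) ≤ ∑ x ∈ univ.filter (fun x => z < Z n x), W n x := by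
  filter_upwards [eventually_le_sum_filter_lt_of_nonneg hW hs hσ hub hlb
    (le_max_right z 0) hc] with n hn
  refine hn.trans (sum_le_sum_of_subset_of_nonneg ?_ fun x _ _ => (hW n).1 x)
  intro x
  simp only [mem_filter, mem_univ, true_and]
  exact (le_max_left z 0).trans_lt

end GartnerEllis

/-- `F n` satisfies a large deviation estimate with speed `s` and rate `I`, locally uniformly. -/
def HasRate (s : ℕ → ℝ) (F : ℕ → ℝ → ℝ) (I : ℝ → ℝ) : Prop :=
  ∀ z c, (c < I z → ∀ᶠ y : ℕ × ℝ in atTop ×ˢ 𝓝 z, F y.1 y.2 ≤ exp (-(s y.1 * c))) ∧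
    (I z < c → ∀ᶠ y : ℕ × ℝ in atTop ×ˢ 𝓝 z, exp (-(s y.1 * c)) ≤ F y.1 y.2)

theorem HasRate.of_sandwich {s : ℕ → ℝ} {F V : ℕ → ℝ → ℝ} {I : ℝ → ℝ} (hI : Continuous I)
    (hub : ∀ z c, c < I z → ∀ᶠ n in atTop, V n z ≤ exp (-(s n * c)))
    (hlb : ∀ z c, I z < c → ∀ᶠ n in atTop, exp (-(s n * c)) ≤ V n z)
    (h₁ : ∀ n z z', z < z' → F n z' ≤ V n z) (h₂ : ∀ n z z', z' < z → V n z ≤ F n z') :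
    HasRate s F I := by
  intro z c
  constructor
  · intro hc
    have h : ∀ᶠ z' in 𝓝[<] z, c < I z' :=
      (hI.continuousAt.eventually_const_lt hc).filter_mono nhdsWithin_le_nhds
    obtain ⟨z', hz', hlt⟩ := (h.and self_mem_nhdsWithin).exists
    filter_upwards [(hub z' c hz').prod_mk (lt_mem_nhds hlt)] with y hy
    exact (h₁ _ _ _ hy.2).trans hy.1
  · intro hc
    have h : ∀ᶠ z' in 𝓝[>] z, I z' < c :=
      (hI.continuousAt.eventually_lt_const hc).filter_mono nhdsWithin_le_nhds
    obtain ⟨z', hz', hlt⟩ := (h.and self_mem_nhdsWithin).exists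
    filter_upwards [(hlb z' c hz').prod_mk (gt_mem_nhds hlt)] with y hy
    exact hy.1.trans (h₂ _ _ _ hy.2)

section Tails

variable {α : ℕ → Type*} [∀ n, Fintype (α n)] {W Z : ∀ n, α n → ℝ} {s : ℕ → ℝ} {σ : ℝ}

theorem hasRate_upper (hW : ∀ n, IsProbDist (W n)) (hs : Tendsto s atTop atTop) (hσ : 0 < σ)
    (hub : ∀ l c, l ^ 2 * σ / 2 < c →
      ∀ᶠ n in atTop, ∑ x, W n x * exp (s n * (l * Z n x)) ≤ exp (s n * c))
    (hlb : ∀ l c, c < l ^ 2 * σ / 2 →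
      ∀ᶠ n in atTop, exp (s n * c) ≤ ∑ x, W n x * exp (s n * (l * Z n x))) :
    HasRate s (fun n z => ∑ x ∈ univ.filter (fun x => z < Z n x), W n x) (gaussRate σ) := by
  have hmono : ∀ n z z', z < z' → ∑ x ∈ univ.filter (fun x => z' < Z n x), W n x ≤
      ∑ x ∈ univ.filter (fun x => z < Z n x), W n x := by
    intro n z z' h
    refine sum_le_sum_of_subset_of_nonneg ?_ fun x _ _ => (hW n).1 x
    intro x
    simp only [mem_filter, mem_univ, true_and]
    exact h.trans
  exact HasRate.of_sandwich (continuous_gaussRate σ)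
    (fun z c hc => eventually_sum_filter_lt_le hW hs hσ hub hc)
    (fun z c hc => eventually_le_sum_filter_lt hW hs hσ hub hlb hc) hmono
    (fun n z z' h => hmono n z' z h)

theorem hasRate_lower (hW : ∀ n, IsProbDist (W n)) (hs : Tendsto s atTop atTop) (hσ : 0 < σ)
    (hub : ∀ l c, l ^ 2 * σ / 2 < c →
      ∀ᶠ n in atTop, ∑ x, W n x * exp (s n * (l * Z n x)) ≤ exp (s n * c))
    (hlb : ∀ l c, c < l ^ 2 * σ / 2 →
      ∀ᶠ n in atTop, exp (s n * c) ≤ ∑ x, W n x * exp (s n * (l * Z n x))) :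
    HasRate s (fun n z => ∑ x ∈ univ.filter (fun x => ¬ -z < Z n x), W n x)
      (gaussRate σ) := by
  have hub' : ∀ l c, l ^ 2 * σ / 2 < c →
      ∀ᶠ n in atTop, ∑ x, W n x * exp (s n * (l * (-Z n x))) ≤ exp (s n * c) := by
    intro l c h
    simpa using hub (-l) c (by simpa using h)
  have hlb' : ∀ l c, c < l ^ 2 * σ / 2 →
      ∀ᶠ n in atTop, exp (s n * c) ≤ ∑ x, W n x * exp (s n * (l * (-Z n x))) := by
    intro l c h
    simpa using hlb (-l) c (by simpa using h)
  refine HasRate.of_sandwich (V := fun n z => ∑ x ∈ univ.filter (fun x => z < -Z n x), W n x)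
    (continuous_gaussRate σ)
    (fun z c hc => eventually_sum_filter_lt_le hW hs hσ hub' hc)
    (fun z c hc => eventually_le_sum_filter_lt hW hs hσ hub' hlb' hc) ?_ ?_
  · intro n z z' h
    refine sum_le_sum_of_subset_of_nonneg ?_ fun x _ _ => (hW n).1 x
    intro x
    simp only [mem_filter, mem_univ, true_and]
    intro hx
    linarith
  · intro n z z' h
    refine sum_le_sum_of_subset_of_nonneg ?_ fun x _ _ => (hW n).1 x
    intro x
    simp only [mem_filter, mem_univ, true_and]
    intro hx
    linarith

end Tails

/-! ### Moderate deviations of tensor powers -/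

theorem tendsto_exp_sub_one_sub_div_sq (x : ℝ) :
    Tendsto (fun θ : ℝ => (exp (θ * x) - 1 - θ * x) / θ ^ 2) (𝓝[≠] 0) (𝓝 (x ^ 2 / 2)) := by
  rw [tendsto_iff_norm_sub_tendsto_zero]
  have hsmall : ∀ᶠ θ : ℝ in 𝓝[≠] 0, |θ * x| < 1 := by
    have hcont : Continuous fun θ : ℝ => |θ * x| := by fun_prop
    exact (hcont.continuousAt.eventually_lt_const (by simp)).filter_mono nhdsWithin_le_nhds
  have hlim : Tendsto (fun θ : ℝ => |θ| * |x| ^ 3) (𝓝[≠] 0) (𝓝 0) := by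
    have hcont : Continuous fun θ : ℝ => |θ| * |x| ^ 3 := by fun_prop
    simpa using (hcont.tendsto 0).mono_left nhdsWithin_le_nhds
  refine squeeze_zero' (Eventually.of_forall fun _ => norm_nonneg _) ?_ hlim
  filter_upwards [hsmall, self_mem_nhdsWithin] with θ hθ hθ0
  have hθ0' : θ ≠ 0 := hθ0
  have h := Real.exp_bound hθ.le (n := 3) (by norm_num)
  simp only [sum_range_succ, range_zero, sum_empty, Nat.factorial] at h
  norm_num at h
  have heq : (exp (θ * x) - 1 - θ * x) / θ ^ 2 - x ^ 2 / 2 =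
      (exp (θ * x) - (1 + θ * x + (θ * x) ^ 2 / 2)) / θ ^ 2 := by
    field_simp
    ring
  rw [heq, norm_div, Real.norm_eq_abs, Real.norm_eq_abs, abs_of_nonneg (sq_nonneg θ),
    div_le_iff₀ (by positivity)]
  refine h.trans ?_
  have h3 : |θ| ^ 2 = θ ^ 2 := sq_abs θ
  rw [← h3, mul_pow]
  have : 0 ≤ |θ| ^ 3 * |x| ^ 3 := by positivity
  nlinarith

theorem tendsto_log_mgf_div_sq {α : Type*} [Fintype α] {a : α → ℝ} (ha : IsProbDist a)
    (x : α → ℝ) (hmean : ∑ i, a i * x i = 0) :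
    Tendsto (fun θ : ℝ => log (∑ i, a i * exp (θ * x i)) / θ ^ 2) (𝓝[≠] 0)
      (𝓝 ((∑ i, a i * x i ^ 2) / 2)) := by
  set M : ℝ → ℝ := fun θ => ∑ i, a i * exp (θ * x i) with hM
  have hM0 : M 0 = 1 := by simp [hM, ha.2]
  have hMcont : Continuous M := by
    simp only [hM]
    fun_prop
  have hM1 : Tendsto M (𝓝[≠] 0) (𝓝 1) := by
    rw [← hM0]
    exact (hMcont.tendsto 0).mono_left nhdsWithin_le_nhds
  have hquad : Tendsto (fun θ => (M θ - 1) / θ ^ 2) (𝓝[≠] 0)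
      (𝓝 ((∑ i, a i * x i ^ 2) / 2)) := by
    have h1 : Tendsto (fun θ : ℝ => ∑ i, a i * ((exp (θ * x i) - 1 - θ * x i) / θ ^ 2)) (𝓝[≠] 0)
        (𝓝 (∑ i, a i * (x i ^ 2 / 2))) :=
      tendsto_finsetSum _ fun i _ => (tendsto_exp_sub_one_sub_div_sq (x i)).const_mul (a i)
    have h2 : ∑ i, a i * (x i ^ 2 / 2) = (∑ i, a i * x i ^ 2) / 2 := by
      rw [sum_div]
      exact sum_congr rfl fun i _ => (mul_div_assoc _ _ _).symm
    rw [h2] at h1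
    refine h1.congr fun θ => ?_
    have h3 : M θ - 1 = ∑ i, a i * (exp (θ * x i) - 1 - θ * x i) := by
      have h4 : ∑ i, a i * (θ * x i) = 0 := by
        simp_rw [mul_left_comm _ θ]
        rw [← mul_sum, hmean, mul_zero]
      simp_rw [mul_sub, mul_one]
      rw [sum_sub_distrib, sum_sub_distrib, ha.2, h4, sub_zero]
    rw [h3, sum_div]
    exact sum_congr rfl fun i _ => (mul_div_assoc _ _ _).symm
  have hlow : Tendsto (fun θ => (M θ - 1) / θ ^ 2 * (M θ)⁻¹) (𝓝[≠] 0)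
      (𝓝 ((∑ i, a i * x i ^ 2) / 2)) := by
    simpa using hquad.mul (hM1.inv₀ one_ne_zero)
  have hMpos : ∀ᶠ θ in 𝓝[≠] (0 : ℝ), 0 < M θ := hM1.eventually_const_lt one_pos
  refine tendsto_of_tendsto_of_tendsto_of_le_of_le' hlow hquad ?_ ?_
  · filter_upwards [hMpos] with θ hθ
    have h := Real.one_sub_inv_le_log_of_pos hθ
    calc (M θ - 1) / θ ^ 2 * (M θ)⁻¹ = (1 - (M θ)⁻¹) / θ ^ 2 := by
          field_simp
      _ ≤ log (M θ) / θ ^ 2 := by gcongr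
  · filter_upwards [hMpos] with θ hθ
    have h := Real.log_le_sub_one_of_pos hθ
    gcongr

/-- Relative entropy with respect to the uniform distribution. -/
def relDUnif {α : Type*} [Fintype α] (a : α → ℝ) : ℝ :=
  ∑ x, a x * log (Fintype.card α * a x)

/-- Relative entropy variance with respect to the uniform distribution. -/
def relVUnif {α : Type*} [Fintype α] (a : α → ℝ) : ℝ :=
  ∑ x, a x * (log (Fintype.card α * a x) - relDUnif a) ^ 2

theorem ModerateSeq.tendsto_mul_sq {t : ℕ → ℝ} (ht : ModerateSeq t) :
    Tendsto (fun n : ℕ => n * t n ^ 2) atTop atTop := by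
  refine ((tendsto_pow_atTop two_ne_zero).comp ht.2).congr fun n => ?_
  rw [Function.comp_apply, mul_pow, Real.sq_sqrt (Nat.cast_nonneg n)]

theorem ModerateSeq.eventually_pos {t : ℕ → ℝ} (ht : ModerateSeq t) :
    ∀ᶠ n : ℕ in atTop, 0 < n ∧ 0 < t n := by
  filter_upwards [ht.2.eventually_gt_atTop 0, eventually_gt_atTop 0] with n hn hn0
  exact ⟨hn0, pos_of_mul_pos_right hn (Real.sqrt_nonneg _)⟩

theorem ModerateSeq.tendsto_mul {t : ℕ → ℝ} (ht : ModerateSeq t) :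
    Tendsto (fun n : ℕ => n * t n) atTop atTop := by
  have h1 : Tendsto (fun n : ℕ => √(n : ℝ)) atTop atTop :=
    Real.tendsto_sqrt_atTop.comp tendsto_natCast_atTop_atTop
  refine (h1.atTop_mul_atTop₀ ht.2).congr fun n => ?_
  rw [← mul_assoc, Real.mul_self_sqrt (Nat.cast_nonneg n)]

theorem tendsto_log_mgf_tpow {α : Type*} [Fintype α] {a : α → ℝ} (ha : IsProbDist a) {t : ℕ → ℝ}
    (ht : ModerateSeq t) {m : ℕ → ℕ} {ρ : ℝ}
    (hm : Tendsto (fun n => (m n : ℝ) / n) atTop (𝓝 ρ)) (l : ℝ) :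
    Tendsto (fun n => (m n : ℝ) * log (∑ x, a x *
        exp (l * t n * (log (Fintype.card α * a x) - relDUnif a))) / (n * t n ^ 2)) atTop
      (𝓝 (l ^ 2 * (ρ * relVUnif a) / 2)) := by
  rcases eq_or_ne l 0 with rfl | hl
  · simp [ha.2]
  have hmean : ∑ x, a x * (log (Fintype.card α * a x) - relDUnif a) = 0 := by
    simp_rw [mul_sub]
    rw [sum_sub_distrib, ← sum_mul, ha.2, one_mul]
    exact sub_self _
  have hlt : Tendsto (fun n => l * t n) atTop (𝓝[≠] 0) := by
    rw [tendsto_nhdsWithin_iff]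
    refine ⟨by simpa using ht.1.const_mul l, ?_⟩
    filter_upwards [ht.eventually_pos] with n hn
    exact mul_ne_zero hl hn.2.ne'
  have h1 := ((tendsto_log_mgf_div_sq ha _ hmean).comp hlt).mul (hm.mul_const (l ^ 2))
  have hval : (∑ x, a x * (log (Fintype.card α * a x) - relDUnif a) ^ 2) / 2 * (ρ * l ^ 2) =
      l ^ 2 * (ρ * relVUnif a) / 2 := by
    rw [relVUnif]
    ring
  rw [hval] at h1
  refine h1.congr' ?_
  filter_upwards [ht.eventually_pos] with n hn
  have hn0 : (n : ℝ) ≠ 0 := by exact_mod_cast hn.1.ne'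
  have ht0 := hn.2.ne'
  simp only [Function.comp_apply]
  generalize log (∑ i, a i * exp (l * t n * (log (Fintype.card α * a i) - relDUnif a))) = X
  field_simp

section TensorPower

variable {α : Type*} [Fintype α] [Nonempty α] {a : α → ℝ}

theorem sum_tpow_mul_exp (a : α → ℝ) (m : ℕ) (θ : ℝ) :
    ∑ f : Fin m → α, tpow a m f *
        exp (θ * (log (Fintype.card (Fin m → α) * tpow a m f) - m * relDUnif a)) =
      (∑ x, a x * exp (θ * (log (Fintype.card α * a x) - relDUnif a))) ^ m := by
  rw [Fintype.sum_pow]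
  refine sum_congr rfl fun f _ => ?_
  rw [prod_mul_distrib]
  by_cases h : ∀ j, a (f j) ≠ 0
  · have hcard : (Fintype.card α : ℝ) ≠ 0 := by exact_mod_cast Fintype.card_ne_zero
    have h1 : (Fintype.card (Fin m → α) : ℝ) * tpow a m f =
        ∏ j, (Fintype.card α * a (f j)) := by
      rw [prod_mul_distrib, tpow]
      simp
    rw [h1, Real.log_prod fun j _ => mul_ne_zero hcard (h j), ← Real.exp_sum, ← mul_sum,
      sum_sub_distrib]
    simp [tpow]
  · push Not at h
    obtain ⟨j, hj⟩ := h
    have h0 : ∏ i, a (f i) = 0 := prod_eq_zero (mem_univ j) hj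
    simp [tpow, h0]

theorem upperMass_exp_eq (ha : IsProbDist a) {c D d z : ℝ} (hd : 0 < d)
    (hc : c = D + d * z) :
    upperMass a (exp c) =
      ∑ x ∈ univ.filter (fun x => z < (log (Fintype.card α * a x) - D) / d), a x := by
  have hcard : (0 : ℝ) < Fintype.card α := by exact_mod_cast Fintype.card_pos
  unfold upperMass
  rw [sum_filter, sum_filter]
  refine sum_congr rfl fun x _ => ?_
  rcases (ha.1 x).eq_or_lt with h | h
  · simp [← h]
  · have hiff : exp c < Fintype.card α * a x ↔
        z < (log (Fintype.card α * a x) - D) / d := by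
      rw [← Real.lt_log_iff_exp_lt (by positivity), lt_div_iff₀ hd, hc]
      constructor <;> intro h <;> linarith
    simp only [hiff]

theorem HasRate.congr {s : ℕ → ℝ} {F G : ℕ → ℝ → ℝ} {I : ℝ → ℝ} (hF : HasRate s F I)
    (h : ∀ᶠ n in atTop, ∀ z, F n z = G n z) : HasRate s G I := by
  intro z c
  have h' := h.prod_inl (𝓝 z)
  refine ⟨fun hc => ?_, fun hc => ?_⟩
  · filter_upwards [h', (hF z c).1 hc] with y hy hy'
    rwa [← hy]
  · filter_upwards [h', (hF z c).2 hc] with y hy hy'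
    rwa [← hy]

/-- Moderate deviations of the log-likelihood ratio of tensor powers, in both directions. -/
theorem hasRate_upperMass_tpow (ha : IsProbDist a) (hV : 0 < relVUnif a) {t : ℕ → ℝ}
    (ht : ModerateSeq t) {m : ℕ → ℕ} {ρ : ℝ} (hρ : 0 < ρ)
    (hm : Tendsto (fun n => (m n : ℝ) / n) atTop (𝓝 ρ)) :
    HasRate (fun n => n * t n ^ 2)
        (fun n z => upperMass (tpow a (m n)) (exp (m n * relDUnif a + n * t n * z)))
        (gaussRate (ρ * relVUnif a)) ∧
      HasRate (fun n => n * t n ^ 2)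
        (fun n z => 1 - upperMass (tpow a (m n)) (exp (m n * relDUnif a + n * t n * -z)))
        (gaussRate (ρ * relVUnif a)) := by
  set s : ℕ → ℝ := fun n => n * t n ^ 2 with hs
  have hsT : Tendsto s atTop atTop := ht.tendsto_mul_sq
  have hσ : 0 < ρ * relVUnif a := mul_pos hρ hV
  set W : ∀ n, (Fin (m n) → α) → ℝ := fun n => tpow a (m n) with hW
  set Z : ∀ n, (Fin (m n) → α) → ℝ := fun n f =>
    (log (Fintype.card (Fin (m n) → α) * tpow a (m n) f) - m n * relDUnif a) / (n * t n)
    with hZ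
  have hWp : ∀ n, IsProbDist (W n) := fun n => ha.tpow (m n)
  have hM : ∀ l : ℝ, ∀ᶠ n in atTop, ∑ x, W n x * exp (s n * (l * Z n x)) =
      exp (s n * ((m n : ℝ) * log (∑ x, a x *
        exp (l * t n * (log (Fintype.card α * a x) - relDUnif a))) / (n * t n ^ 2))) := by
    intro l
    filter_upwards [ht.eventually_pos] with n hn
    have hn0 : (n : ℝ) ≠ 0 := by exact_mod_cast hn.1.ne'
    have ht0 := hn.2.ne'
    have hpos : 0 < ∑ x, a x *
        exp (l * t n * (log (Fintype.card α * a x) - relDUnif a)) := by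
      obtain ⟨x, hx⟩ : ∃ x, 0 < a x := by
        by_contra! hcon
        have h0 : ∑ x, a x ≤ 0 := sum_nonpos fun x _ => hcon x
        linarith [ha.2]
      exact sum_pos' (fun y _ => mul_nonneg (ha.1 y) (Real.exp_pos _).le)
        ⟨x, mem_univ x, mul_pos hx (Real.exp_pos _)⟩
    have hexp : ∀ f, s n * (l * Z n f) = l * t n *
        (log (Fintype.card (Fin (m n) → α) * tpow a (m n) f) - m n * relDUnif a) := by
      intro f
      simp only [hs, hZ]
      field_simp
    simp_rw [hexp]
    rw [sum_tpow_mul_exp, show s n = n * t n ^ 2 from rfl, mul_div_cancel₀ _ (by positivity),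
      Real.exp_nat_mul, Real.exp_log hpos]
  have hub : ∀ l c, l ^ 2 * (ρ * relVUnif a) / 2 < c →
      ∀ᶠ n in atTop, ∑ x, W n x * exp (s n * (l * Z n x)) ≤ exp (s n * c) := by
    intro l c hc
    filter_upwards [hM l, (tendsto_log_mgf_tpow ha ht hm l).eventually_lt_const hc,
      hsT.eventually_ge_atTop 0] with n h1 h2 h3
    rw [h1]
    gcongr
  have hlb : ∀ l c, c < l ^ 2 * (ρ * relVUnif a) / 2 →
      ∀ᶠ n in atTop, exp (s n * c) ≤ ∑ x, W n x * exp (s n * (l * Z n x)) := by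
    intro l c hc
    filter_upwards [hM l, (tendsto_log_mgf_tpow ha ht hm l).eventually_const_lt hc,
      hsT.eventually_ge_atTop 0] with n h1 h2 h3
    rw [h1]
    gcongr
  have hpos : ∀ᶠ n : ℕ in atTop, 0 < n * t n := ht.tendsto_mul.eventually_gt_atTop 0
  constructor
  · refine (hasRate_upper hWp hsT hσ hub hlb).congr ?_
    filter_upwards [hpos] with n hn z
    exact (upperMass_exp_eq (hWp n) hn rfl).symm
  · refine (hasRate_lower hWp hsT hσ hub hlb).congr ?_
    filter_upwards [hpos] with n hn z
    rw [upperMass_exp_eq (ha.tpow (m n)) hn rfl, sub_eq_of_eq_add']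
    rw [sum_filter_add_sum_filter_not, (hWp n).2]

end TensorPower

theorem gaussRate_lt_gaussRate {σ τ x y : ℝ} (hσ : 0 < σ) (hτ : 0 < τ) (hy : 0 < y)
    (h : x * √τ < y * √σ) : gaussRate σ x < gaussRate τ y := by
  have h1 : max x 0 * √τ < y * √σ := by
    rcases le_total x 0 with hx | hx
    · rw [max_eq_right hx, zero_mul]
      positivity
    · rwa [max_eq_left hx]
  have h2 := pow_lt_pow_left₀ h1 (mul_nonneg (le_max_right x 0) (Real.sqrt_nonneg τ)) two_ne_zero
  rw [mul_pow, mul_pow, Real.sq_sqrt hσ.le, Real.sq_sqrt hτ.le] at h2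
  rw [gaussRate, gaussRate, max_eq_left hy.le, div_lt_div_iff₀ (by positivity) (by positivity)]
  linarith

theorem gaussRate_lt_one {σ x : ℝ} (hσ : 0 < σ) (h : x < √2 * √σ) : gaussRate σ x < 1 := by
  have h1 : gaussRate σ (√2 * √σ) = 1 := by
    rw [gaussRate, max_eq_left (by positivity), mul_pow, Real.sq_sqrt hσ.le,
      Real.sq_sqrt zero_le_two, div_self (by positivity)]
  rw [← h1]
  exact gaussRate_lt_gaussRate hσ hσ (by positivity)
    (mul_lt_mul_of_pos_right h (Real.sqrt_pos.mpr hσ))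

theorem one_lt_gaussRate {σ x : ℝ} (hσ : 0 < σ) (h : √2 * √σ < x) : 1 < gaussRate σ x := by
  have h1 : gaussRate σ (√2 * √σ) = 1 := by
    rw [gaussRate, max_eq_left (by positivity), mul_pow, Real.sq_sqrt hσ.le,
      Real.sq_sqrt zero_le_two, div_self (by positivity)]
  rw [← h1]
  have h0 : 0 ≤ √2 * √σ := by positivity
  exact gaussRate_lt_gaussRate hσ hσ (h0.trans_lt h)
    (mul_lt_mul_of_pos_right h (Real.sqrt_pos.mpr hσ))

theorem HasRate.comp_affine {s : ℕ → ℝ} {F : ℕ → ℝ → ℝ} {I : ℝ → ℝ} (hF : HasRate s F I) (κ : ℝ)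
    {δ : ℕ → ℝ} {w : ℝ} (hδ : Tendsto δ atTop (𝓝 w)) :
    HasRate s (fun n z => F n (κ * z + δ n)) (fun z => I (κ * z + w)) := by
  intro z c
  have hmap : Tendsto (fun y : ℕ × ℝ => (y.1, κ * y.2 + δ y.1)) (atTop ×ˢ 𝓝 z)
      (atTop ×ˢ 𝓝 (κ * z + w)) :=
    tendsto_fst.prodMk ((tendsto_snd.const_mul κ).add (hδ.comp tendsto_fst))
  exact ⟨fun hc => hmap.eventually ((hF _ c).1 hc), fun hc => hmap.eventually ((hF _ c).2 hc)⟩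

theorem HasRate.shift {s : ℕ → ℝ} {F : ℕ → ℝ → ℝ} {I : ℝ → ℝ} (hF : HasRate s F I)
    {δ : ℕ → ℝ} {w : ℝ} (hδ : Tendsto δ atTop (𝓝 w)) :
    HasRate s (fun n z => F n (z + δ n)) (fun z => I (z + w)) := by
  simpa using hF.comp_affine 1 hδ

theorem hasRate_const {s : ℕ → ℝ} (hs : Tendsto s atTop atTop) (c : ℝ) :
    HasRate s (fun n _ => exp (-(s n * c))) (fun _ => c) := by
  intro z c'
  have h0 := (hs.eventually_ge_atTop 0).prod_inl (𝓝 z)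
  refine ⟨fun hc => ?_, fun hc => ?_⟩ <;>
  · filter_upwards [h0] with y hy
    gcongr

theorem HasRate.eventually_mul_le {s : ℕ → ℝ} (hs : Tendsto s atTop atTop) {F G : ℕ → ℝ → ℝ}
    {I J : ℝ → ℝ} (hF : HasRate s F I) (hG : HasRate s G J) {z : ℝ} (h : J z < I z) {C : ℝ}
    (hC : 0 ≤ C) : ∀ᶠ y : ℕ × ℝ in atTop ×ˢ 𝓝 z, C * F y.1 y.2 ≤ G y.1 y.2 := by
  obtain ⟨c, hc1, hc2⟩ := exists_between h
  obtain ⟨c', hc1', hc2'⟩ := exists_between hc2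
  filter_upwards [(hG z c).2 hc1, (hF z c').1 hc2',
    (eventually_mul_exp_le hs C (neg_lt_neg hc1')).prod_inl (𝓝 z)] with y h1 h2 h3
  calc C * F y.1 y.2 ≤ C * exp (-(s y.1 * c')) := by gcongr
    _ ≤ exp (-(s y.1 * c)) := by simpa [mul_neg] using h3
    _ ≤ G y.1 y.2 := h1

/-- Evaluating a locally uniform statement at a fixed point. -/
theorem eventually_of_prod_nhds {p : ℕ × ℝ → Prop} {z : ℝ}
    (h : ∀ᶠ y in atTop ×ˢ 𝓝 z, p y) : ∀ᶠ n in atTop, p (n, z) :=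
  (tendsto_id.prodMk tendsto_const_nhds).eventually h

/-- A locally uniform statement holds uniformly on compact sets. -/
theorem eventually_forall_of_isCompact {p : ℕ × ℝ → Prop} {K : Set ℝ} (hK : IsCompact K)
    (h : ∀ z ∈ K, ∀ᶠ y in atTop ×ˢ 𝓝 z, p y) : ∀ᶠ n in atTop, ∀ z ∈ K, p (n, z) := by
  have h1 : {y | p y} ∈ atTop ×ˢ 𝓝ˢ K := hK.mem_prod_nhdsSet_of_forall h
  obtain ⟨S, hS, T, hT, hST⟩ := Filter.mem_prod_iff.mp h1
  filter_upwards [hS] with n hn z hz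
  exact hST ⟨hn, subset_of_mem_nhdsSet hT hz⟩

/-- The tail rates of a tensor power, measured on a prescribed logarithmic scale. -/
theorem hasRate_upperMass_tpow_shift {α : Type*} [Fintype α] [Nonempty α] {a : α → ℝ}
    (ha : IsProbDist a) (hV : 0 < relVUnif a) {t : ℕ → ℝ} (ht : ModerateSeq t) {m : ℕ → ℕ} {ρ : ℝ}
    (hρ : 0 < ρ) (hm : Tendsto (fun n => (m n : ℝ) / n) atTop (𝓝 ρ)) {E : ℕ → ℝ} {w : ℝ}
    (hE : Tendsto (fun n => (E n - m n * relDUnif a) / (n * t n)) atTop (𝓝 w)) :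
    HasRate (fun n => n * t n ^ 2)
        (fun n z => upperMass (tpow a (m n)) (exp (E n + n * t n * z)))
        (fun z => gaussRate (ρ * relVUnif a) (z + w)) ∧
      HasRate (fun n => n * t n ^ 2)
        (fun n z => 1 - upperMass (tpow a (m n)) (exp (E n + n * t n * z)))
        (fun z => gaussRate (ρ * relVUnif a) (-(z + w))) := by
  obtain ⟨h1, h2⟩ := hasRate_upperMass_tpow ha hV ht hρ hm
  have hne : ∀ᶠ n : ℕ in atTop, (n : ℝ) * t n ≠ 0 :=
    (ht.tendsto_mul.eventually_gt_atTop 0).mono fun n hn => hn.ne'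
  constructor
  · refine (h1.shift hE).congr ?_
    filter_upwards [hne] with n hn z
    rw [mul_add, mul_div_cancel₀ _ hn]
    ring_nf
  · have h3 := h2.comp_affine (-1) hE.neg
    simp only [neg_one_mul, ← neg_add] at h3
    refine h3.congr ?_
    filter_upwards [hne] with n hn z
    rw [neg_neg, mul_add, mul_div_cancel₀ _ hn]
    ring_nf

theorem hasRate_upperMass_tpow_self {α : Type*} [Fintype α] [Nonempty α] {a : α → ℝ}
    (ha : IsProbDist a) (hV : 0 < relVUnif a) {t : ℕ → ℝ} (ht : ModerateSeq t) :
    HasRate (fun n => n * t n ^ 2)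
        (fun n z => upperMass (tpow a n) (exp (n * relDUnif a + n * t n * z)))
        (gaussRate (relVUnif a)) ∧
      HasRate (fun n => n * t n ^ 2)
        (fun n z => 1 - upperMass (tpow a n) (exp (n * relDUnif a + n * t n * z)))
        (fun z => gaussRate (relVUnif a) (-z)) := by
  have hm : Tendsto (fun n : ℕ => (n : ℝ) / n) atTop (𝓝 1) := by
    refine tendsto_const_nhds.congr' ?_
    filter_upwards [eventually_gt_atTop 0] with n hn
    rw [div_self (by exact_mod_cast hn.ne')]
  have h := hasRate_upperMass_tpow_shift ha hV ht one_pos hm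
    (E := fun n => n * relDUnif a) (w := 0) (by simp)
  simpa only [one_mul, add_zero] using h

section Conversion

variable {α β : Type*} [Fintype α] [Fintype β] [Nonempty α] [Nonempty β] {N : ℕ} [NeZero N]
  {P : α → ℝ} {Q : β → ℝ}

/-- Converse: rates beyond the critical second-order term are not achievable. -/
theorem eventually_not_convertible (hP : IsProbDist P) (hQ : IsProbDist Q)
    (hα : Fintype.card α = N) (hβ : Fintype.card β = N) (hVP : 0 < relVUnif P)
    (hVQ : 0 < relVUnif Q) {t : ℕ → ℝ} (ht : ModerateSeq t) {m : ℕ → ℕ} {ρ w : ℝ} (hρ : 0 < ρ)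
    (hm : Tendsto (fun n => (m n : ℝ) / n) atTop (𝓝 ρ))
    (hE : Tendsto (fun n => (n * relDUnif P - m n * relDUnif Q) / (n * t n)) atTop (𝓝 w))
    (hw : w < √2 * |√(relVUnif P) - √(ρ * relVUnif Q)|) :
    ∀ᶠ n in atTop, ∀ M, m n ≤ M → ¬ Convertible P Q N n M (exp (-(n * t n ^ 2))) := by
  have hs := ht.tendsto_mul_sq
  have hB : 0 < ρ * relVUnif Q := mul_pos hρ hVQ
  obtain ⟨hP₁, hP₂⟩ := hasRate_upperMass_tpow_self hP hVP ht
  obtain ⟨hQ₁, hQ₂⟩ := hasRate_upperMass_tpow_shift hQ hVQ ht hρ hm hE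
  have hε := hasRate_const hs 1
  have ht2 : Tendsto (fun n => 2 * t n) atTop (𝓝 0) := by simpa using ht.1.const_mul 2
  have hQ₁' := hQ₁.shift ht2
  have hQ₂' := hQ₂.shift ht2
  have hkey : ∀ z : ℝ, ∀ n : ℕ, ∀ M, m n ≤ M → Convertible P Q N n M (exp (-(n * t n ^ 2))) →
      0 ≤ n * t n ^ 2 →
      upperMass (tpow Q (m n)) (exp (n * relDUnif P + n * t n * (z + 2 * t n))) ≤
          2 * upperMass (tpow P n) (exp (n * relDUnif P + n * t n * z)) +
            6 * exp (-(n * t n ^ 2)) ∧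
        1 - upperMass (tpow P n) (exp (n * relDUnif P + n * t n * z)) ≤
          2 * (1 - upperMass (tpow Q (m n))
            (exp (n * relDUnif P + n * t n * (z + 2 * t n)))) + 5 * exp (-(n * t n ^ 2)) := by
    intro z n M hM hc hs0
    have h := hc.upperMass_le hP hQ hα hβ hM
      (Real.exp_pos (n * relDUnif P + n * t n * z)).le
      (Real.exp_pos (n * relDUnif P + n * t n * (z + 2 * t n)))
    rw [← Real.exp_sub] at h
    have h1 : exp (n * relDUnif P + n * t n * z - (n * relDUnif P + n * t n * (z + 2 * t n))) ≤
        exp (-(n * t n ^ 2)) := by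
      gcongr
      nlinarith
    constructor <;> linarith [h.1, h.2, Real.exp_pos (-(n * t n ^ 2))]
  rcases le_total (√(relVUnif P)) (√(ρ * relVUnif Q)) with hle | hle
  · rw [abs_of_nonpos (sub_nonpos.mpr hle)] at hw
    obtain ⟨z, hz1, hz2⟩ := exists_between
      (show √2 * √(relVUnif P) < √2 * √(ρ * relVUnif Q) - w by linarith)
    have h1 := eventually_of_prod_nhds (hP₁.eventually_mul_le hs hε
      (one_lt_gaussRate hVP hz1) (zero_le_one))
    have h2 := eventually_of_prod_nhds (hε.eventually_mul_le hs hQ₁' (z := z)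
      (gaussRate_lt_one hB (by linarith)) (show (0 : ℝ) ≤ 16 by norm_num))
    filter_upwards [h1, h2, hs.eventually_ge_atTop 0] with n h1 h2 h0 M hM hc
    have h3 := (hkey z n M hM hc h0).1
    simp only [mul_one, one_mul] at h1 h2
    linarith [Real.exp_pos (-(n * t n ^ 2))]
  · rw [abs_of_nonneg (sub_nonneg.mpr hle)] at hw
    obtain ⟨z, hz1, hz2⟩ := exists_between
      (show -(√2 * √(relVUnif P)) < -(√2 * √(ρ * relVUnif Q)) - w by linarith)
    have h1 := eventually_of_prod_nhds (hQ₂'.eventually_mul_le hs hε (z := z)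
      (one_lt_gaussRate hB (by linarith)) (zero_le_one))
    have h2 := eventually_of_prod_nhds (hε.eventually_mul_le hs hP₂ (z := z)
      (gaussRate_lt_one hVP (by linarith)) (show (0 : ℝ) ≤ 16 by norm_num))
    filter_upwards [h1, h2, hs.eventually_ge_atTop 0] with n h1 h2 h0 M hM hc
    have h3 := (hkey z n M hM hc h0).2
    simp only [mul_one, one_mul] at h1 h2
    linarith [Real.exp_pos (-(n * t n ^ 2))]

end Conversion

/-- Achievability: rates below the critical second-order term are achievable. -/
theorem eventually_convertible {α β : Type*} [Fintype α] [Fintype β] [Nonempty α] [Nonempty β]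
    {N : ℕ} [NeZero N] {P : α → ℝ} {Q : β → ℝ} (hP : IsProbDist P) (hQ : IsProbDist Q)
    (hα : Fintype.card α = N) (hβ : Fintype.card β = N) (hDP : 0 < relDUnif P)
    (hVP : 0 < relVUnif P) (hVQ : 0 < relVUnif Q) {t : ℕ → ℝ} (ht : ModerateSeq t) {m : ℕ → ℕ}
    {ρ w : ℝ} (hρ : 0 < ρ) (hm : Tendsto (fun n => (m n : ℝ) / n) atTop (𝓝 ρ))
    (hE : Tendsto (fun n => (n * relDUnif P - m n * relDUnif Q) / (n * t n)) atTop (𝓝 w))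
    (hw : √2 * |√(relVUnif P) - √(ρ * relVUnif Q)| < w) :
    ∀ᶠ n in atTop, Convertible P Q N n (m n) (exp (-(n * t n ^ 2))) := by
  have hs := ht.tendsto_mul_sq
  have hB : 0 < ρ * relVUnif Q := mul_pos hρ hVQ
  obtain ⟨hP₁, hP₂⟩ := hasRate_upperMass_tpow_self hP hVP ht
  obtain ⟨hQ₁, hQ₂⟩ := hasRate_upperMass_tpow_shift hQ hVQ ht hρ hm hE
  have hε := hasRate_const hs 1
  set σ := relVUnif P with hσ
  set τ := ρ * relVUnif Q with hτ
  have h2 : 0 < √2 := by positivity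
  have hσ' : 0 < √σ := Real.sqrt_pos.mpr hVP
  have hw0 : 0 < w := lt_of_le_of_lt (by positivity) hw
  have hw₁ : √2 * (√σ - √τ) < w :=
    (mul_le_mul_of_nonneg_left (le_abs_self _) h2.le).trans_lt hw
  have hw₂ : √2 * (√τ - √σ) < w := by
    rw [abs_sub_comm] at hw
    exact (mul_le_mul_of_nonneg_left (le_abs_self _) h2.le).trans_lt hw
  set z₂ := √2 * √σ with hz₂
  obtain ⟨u, hu₁, hu₂⟩ : ∃ u, u * (√σ - √τ) < w * √σ ∧ z₂ < u := by
    have hcont : Continuous fun u : ℝ => u * (√σ - √τ) := by fun_prop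
    have h0 : z₂ * (√σ - √τ) < w * √σ := by
      rw [hz₂, mul_right_comm]
      gcongr
    have h1 : ∀ᶠ u in 𝓝[>] z₂, u * (√σ - √τ) < w * √σ :=
      (hcont.continuousAt.eventually_lt_const h0).filter_mono nhdsWithin_le_nhds
    exact (h1.and self_mem_nhdsWithin).exists
  have hz₂0 : 0 < z₂ := by positivity
  set C := u ^ 2 / (2 * σ) + 2 with hC
  have hC2 : 2 ≤ C := by
    have : 0 ≤ u ^ 2 / (2 * σ) := by positivity
    linarith
  have hεC := hasRate_const hs C
  have htC : Tendsto (fun n => C * t n) atTop (𝓝 0) := by simpa using ht.1.const_mul C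
  have hκ : Tendsto (fun n : ℕ => log 2 / (n * t n)) atTop (𝓝 0) := ht.tendsto_mul.const_div_atTop _
  have hP₁' := hP₁.shift hκ
  have hQ₁' := hQ₁.shift hκ.neg
  have hP₂' := hP₂.shift htC
  simp only [neg_zero, add_zero] at hP₁' hQ₁' hP₂'
  have ehead := eventually_of_prod_nhds (hQ₁'.eventually_mul_le hs hε (z := z₂)
    (one_lt_gaussRate hB (by linarith)) zero_le_two)
  have etail := eventually_of_prod_nhds (hP₂'.eventually_mul_le hs hε (z := -u)
    (one_lt_gaussRate hVP (by rwa [neg_neg])) (show (0 : ℝ) ≤ 4 by norm_num))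
  have etail' := eventually_of_prod_nhds (hεC.eventually_mul_le hs hε (z := 0)
    (by linarith) (show (0 : ℝ) ≤ 4 by norm_num))
  have emid₁ := eventually_forall_of_isCompact (isCompact_Icc (a := -(w / 2)) (b := z₂))
    fun z hz => hQ₁'.eventually_mul_le hs hP₁' (z := z) (by
      refine gaussRate_lt_gaussRate hVP hB (by linarith [hz.1]) ?_
      rcases le_total z 0 with hz0 | hz0
      · have h3 : z * √τ ≤ 0 := mul_nonpos_of_nonpos_of_nonneg hz0 (Real.sqrt_nonneg τ)
        have h4 : 0 < (z + w) * √σ := mul_pos (by linarith [hz.1]) hσ'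
        linarith
      · have h3 : z * (√τ - √σ) < w * √σ := by
          rcases le_total (√τ) (√σ) with hle | hle
          · have h4 : z * (√τ - √σ) ≤ 0 :=
              mul_nonpos_of_nonneg_of_nonpos hz0 (sub_nonpos.mpr hle)
            have : 0 < w * √σ := by positivity
            linarith
          · calc z * (√τ - √σ) ≤ z₂ * (√τ - √σ) :=
                  mul_le_mul_of_nonneg_right hz.2 (sub_nonneg.mpr hle)
              _ = √2 * (√τ - √σ) * √σ := by rw [hz₂]; ring
              _ < w * √σ := by gcongr
        linarith) zero_le_two
  have hrate : ∀ z ∈ Set.Icc (-u) (-(w / 2)), gaussRate τ (-(z + w)) < gaussRate σ (-z) := by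
    intro z hz
    refine gaussRate_lt_gaussRate hB hVP (by linarith [hz.2]) ?_
    have h3 : -z * (√σ - √τ) < w * √σ := by
      rcases le_total (√σ) (√τ) with hle | hle
      · have h4 : -z * (√σ - √τ) ≤ 0 :=
          mul_nonpos_of_nonneg_of_nonpos (by linarith [hz.2]) (sub_nonpos.mpr hle)
        have : 0 < w * √σ := by positivity
        linarith
      · exact (mul_le_mul_of_nonneg_right (by linarith [hz.1]) (sub_nonneg.mpr hle)).trans_lt hu₁
    linarith
  have emid₂ := eventually_forall_of_isCompact (isCompact_Icc (a := -u) (b := -(w / 2)))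
    fun z hz => hP₂'.eventually_mul_le hs hQ₂ (z := z) (hrate z hz)
      (show (0 : ℝ) ≤ 4 by norm_num)
  have emid₂' := eventually_forall_of_isCompact (isCompact_Icc (a := -u) (b := -(w / 2)))
    fun z hz => hεC.eventually_mul_le hs hQ₂ (z := z) (by
      refine (hrate z hz).trans_le ?_
      have h3 : gaussRate σ (-z) ≤ u ^ 2 / (2 * σ) := by
        rw [gaussRate, max_eq_left (by linarith [hz.2])]
        have : -z ≤ u := by linarith [hz.1]
        have : 0 ≤ -z := by linarith [hz.2]
        gcongr
      linarith) (show (0 : ℝ) ≤ 4 by norm_num)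
  have etw : ∀ᶠ n in atTop, t n * (w / 2) < relDUnif P :=
    Tendsto.eventually_lt_const hDP (by simpa using ht.1.mul_const (w / 2))
  filter_upwards [ehead, etail, etail', emid₁, emid₂, emid₂', etw,
    hκ.eventually_lt_const (half_pos hw0), ht.eventually_pos,
    hs.eventually_ge_atTop 0] with n ehead etail etail' emid₁ emid₂ emid₂' etw hκn hpos hs0
  have hnt : 0 < n * t n := mul_pos (by exact_mod_cast hpos.1) hpos.2
  have hn0 : (0 : ℝ) < n := by exact_mod_cast hpos.1
  set e := exp (-(n * t n ^ 2)) with he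
  have he0 : 0 < e := Real.exp_pos _
  simp only [mul_one] at ehead etail etail'
  rw [← he] at ehead etail etail'
  have he1 : e ≤ 1 := Real.exp_le_one_iff.mpr (neg_nonpos.mpr hs0)
  set r : ℝ → ℝ := fun z => exp (n * relDUnif P + n * t n * z) with hr
  have hr_half : ∀ z, r z / 2 = r (z + -(log 2 / (n * t n))) := by
    intro z
    simp only [hr]
    rw [mul_add, mul_neg, mul_div_cancel₀ _ hnt.ne', ← add_assoc, Real.exp_add _ (-log 2), Real.exp_neg,
      Real.exp_log two_pos, div_eq_mul_inv]
  have hr_two : ∀ z, 2 * r z = r (z + log 2 / (n * t n)) := by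
    intro z
    simp only [hr]
    rw [mul_add, mul_div_cancel₀ _ hnt.ne', ← add_assoc, Real.exp_add _ (log 2), Real.exp_log two_pos,
      mul_comm]
  have hr_div : ∀ z, r z / r (z + C * t n) = exp (-(n * t n ^ 2 * C)) := by
    intro z
    simp only [hr]
    rw [← Real.exp_sub]
    congr 1
    ring
  have hr_pos : ∀ z, 0 < r z := fun z => Real.exp_pos _
  have hr_mono : ∀ z z', z ≤ z' → r z ≤ r z' := by
    intro z z' h
    simp only [hr]
    gcongr
  have hr_one : ∀ z, -(w / 2) ≤ z → 1 ≤ r z := by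
    intro z hz
    refine Real.one_le_exp ?_
    have h3 : 0 ≤ n * (relDUnif P + t n * z) := by
      refine mul_nonneg hn0.le ?_
      nlinarith [hpos.2]
    linarith
  obtain ⟨b, hb, hhock, hfid⟩ := exists_hockey_le_of_upperMass (hP.tpow n) (hQ.tpow (m n))
    (half_pos he0) (by linarith) (hr_one z₂ (by linarith)) (r₁ := r (-u)) (r₂ := r z₂)
    (by rw [hr_half]; linarith)
    ⟨r (-u + C * t n), hr_pos _, by rw [hr_div]; linarith⟩
    (by
      intro x hx₁ hx₂
      have hx0 : 0 < x := (hr_pos _).trans_le hx₁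
      obtain ⟨z, rfl⟩ : ∃ z, x = r z := by
        refine ⟨(log x - n * relDUnif P) / (n * t n), ?_⟩
        simp only [hr]
        rw [mul_div_cancel₀ _ hnt.ne', add_sub_cancel, Real.exp_log hx0]
      have hz : ∀ z z', r z ≤ r z' → z ≤ z' := by
        intro z z' h
        have := Real.exp_le_exp.mp h
        exact le_of_mul_le_mul_left (by linarith) hnt
      rcases le_total (-(w / 2)) z with hzw | hzw
      · have h3 := emid₁ z ⟨hzw, hz _ _ hx₂⟩
        refine Or.inl ⟨by linarith [hr_one z hzw], ?_⟩
        rw [hr_half, hr_two]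
        linarith
      · have hzI : z ∈ Set.Icc (-u) (-(w / 2)) := ⟨hz _ _ hx₁, hzw⟩
        have h3 := emid₂ z hzI
        have h4 := emid₂' z hzI
        refine Or.inr ⟨?_, r (z + C * t n), hr_pos _, ?_⟩
        · rw [hr_half]
          exact hr_mono _ _ (by linarith)
        · rw [hr_div]
          linarith)
  exact convertible_of_hockey_le hP hα hβ hb hhock (by linarith)

theorem tendsto_of_abs_sub_le_one {t : ℕ → ℝ} (ht : ModerateSeq t) {D D' w : ℝ} (hD' : 0 < D')
    {m : ℕ → ℕ} (hm : ∀ᶠ n : ℕ in atTop, |(m n : ℝ) - n * (D / D' - w / D' * t n)| ≤ 1) :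
    Tendsto (fun n => (m n : ℝ) / n) atTop (𝓝 (D / D')) ∧
      Tendsto (fun n => (n * D - m n * D') / (n * t n)) atTop (𝓝 w) := by
  have herr : Tendsto (fun n : ℕ => ((m n : ℝ) - n * (D / D' - w / D' * t n)) / (n * t n)) atTop
      (𝓝 0) := by
    refine squeeze_zero_norm' ?_ (ht.tendsto_mul.const_div_atTop 1)
    filter_upwards [hm, ht.tendsto_mul.eventually_gt_atTop 0] with n hn hpos
    rw [norm_div, Real.norm_eq_abs, Real.norm_eq_abs, abs_of_pos hpos]
    gcongr
  constructor
  · have h : Tendsto (fun n => D / D' - w / D' * t n +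
        ((m n : ℝ) - n * (D / D' - w / D' * t n)) / (n * t n) * t n) atTop
        (𝓝 (D / D' - w / D' * 0 + 0 * 0)) :=
      ((ht.1.const_mul _).const_sub _).add (herr.mul ht.1)
    simp only [mul_zero, sub_zero, add_zero] at h
    refine h.congr' ?_
    filter_upwards [ht.eventually_pos] with n hn
    have hn0 : (n : ℝ) ≠ 0 := by exact_mod_cast hn.1.ne'
    have ht0 := hn.2.ne'
    field_simp
    ring
  · have h : Tendsto (fun n => w - D' *
        (((m n : ℝ) - n * (D / D' - w / D' * t n)) / (n * t n))) atTop (𝓝 (w - D' * 0)) :=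
      (herr.const_mul _).const_sub _
    simp only [mul_zero, sub_zero] at h
    refine h.congr' ?_
    filter_upwards [ht.eventually_pos] with n hn
    have hn0 : (n : ℝ) ≠ 0 := by exact_mod_cast hn.1.ne'
    have ht0 := hn.2.ne'
    field_simp
    ring

/-- Second-order asymptotics of the optimal number of output copies. -/
theorem tendsto_sSup_convertible {α β : Type*} [Fintype α] [Fintype β] [Nonempty α] [Nonempty β]
    {N : ℕ} [NeZero N] {P : α → ℝ} {Q : β → ℝ} (hP : IsProbDist P) (hQ : IsProbDist Q)
    (hα : Fintype.card α = N) (hβ : Fintype.card β = N) (hDP : 0 < relDUnif P)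
    (hDQ : 0 < relDUnif Q) (hVP : 0 < relVUnif P) (hVQ : 0 < relVUnif Q) {t : ℕ → ℝ}
    (ht : ModerateSeq t) :
    Tendsto (fun n : ℕ =>
        ((↑(sSup {m : ℕ | Convertible P Q N n m (exp (-(n * t n ^ 2)))}) : ℝ) / n -
          relDUnif P / relDUnif Q) / t n) atTop
      (𝓝 (-(√2 * |√(relVUnif P) - √(relDUnif P / relDUnif Q * relVUnif Q)|) / relDUnif Q)) := by
  set D := relDUnif P with hD
  set D' := relDUnif Q with hD'
  have hρ : 0 < D / D' := div_pos hDP hDQ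
  set wc := √2 * |√(relVUnif P) - √(D / D' * relVUnif Q)| with hwc
  have hx0 : ∀ w, ∀ᶠ n : ℕ in atTop, 0 ≤ n * (D / D' - w / D' * t n) := by
    intro w
    have h : Tendsto (fun n => D / D' - w / D' * t n) atTop (𝓝 (D / D' - w / D' * 0)) :=
      (ht.1.const_mul _).const_sub _
    rw [mul_zero, sub_zero] at h
    filter_upwards [h.eventually_const_lt hρ] with n hn
    positivity
  have hup : ∀ w, w < wc → ∃ m : ℕ → ℕ,
      Tendsto (fun n => (n * D - m n * D') / (n * t n)) atTop (𝓝 w) ∧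
      ∀ᶠ n in atTop, ∀ M, m n ≤ M → ¬ Convertible P Q N n M (exp (-(n * t n ^ 2))) := by
    intro w hw
    obtain ⟨h1, h2⟩ := tendsto_of_abs_sub_le_one ht hDQ (D := D) (w := w)
      (m := fun n => ⌈(n : ℝ) * (D / D' - w / D' * t n)⌉₊) (by
        filter_upwards [hx0 w] with n hn
        rw [abs_le]
        constructor <;> linarith [Nat.le_ceil ((n : ℝ) * (D / D' - w / D' * t n)),
          Nat.ceil_lt_add_one hn])
    exact ⟨_, h2, eventually_not_convertible hP hQ hα hβ hVP hVQ ht hρ h1 h2 hw⟩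
  have hdown : ∀ w, wc < w → ∃ m : ℕ → ℕ,
      Tendsto (fun n => (n * D - m n * D') / (n * t n)) atTop (𝓝 w) ∧
      ∀ᶠ n in atTop, Convertible P Q N n (m n) (exp (-(n * t n ^ 2))) := by
    intro w hw
    obtain ⟨h1, h2⟩ := tendsto_of_abs_sub_le_one ht hDQ (D := D) (w := w)
      (m := fun n => ⌊(n : ℝ) * (D / D' - w / D' * t n)⌋₊) (by
        filter_upwards [hx0 w] with n hn
        rw [abs_le]
        constructor <;> linarith [Nat.floor_le hn,
          Nat.lt_floor_add_one ((n : ℝ) * (D / D' - w / D' * t n))])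
    exact ⟨_, h2, eventually_convertible hP hQ hα hβ hDP hVP hVQ ht hρ h1 h2 hw⟩
  have hrate : ∀ {m : ℕ → ℕ} {w : ℝ},
      Tendsto (fun n => (n * D - m n * D') / (n * t n)) atTop (𝓝 w) →
      Tendsto (fun n => ((m n : ℝ) / n - D / D') / t n) atTop (𝓝 (-w / D')) := by
    intro m w h
    refine (h.neg.div_const D').congr' ?_
    filter_upwards [ht.eventually_pos] with n hn
    have hn0 : (n : ℝ) ≠ 0 := by exact_mod_cast hn.1.ne'
    have ht0 := hn.2.ne'
    field_simp
    ring
  have hmono : ∀ {n a b : ℕ}, 0 < t n → a ≤ b →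
      ((a : ℝ) / n - D / D') / t n ≤ ((b : ℝ) / n - D / D') / t n := by
    intro n a b htn hab
    gcongr
  refine tendsto_order.mpr ⟨fun x hx => ?_, fun x hx => ?_⟩
  · obtain ⟨w, hw₁, hw₂⟩ := exists_between (show wc < -(x * D') by
      rw [lt_div_iff₀ hDQ] at hx
      linarith)
    obtain ⟨m, h1, h2⟩ := hdown w hw₁
    obtain ⟨m', -, h2'⟩ := hup (wc - 1) (by linarith)
    have hxw : x < -w / D' := by
      rw [lt_div_iff₀ hDQ]
      linarith
    filter_upwards [(hrate h1).eventually_const_lt hxw, h2, h2', ht.eventually_pos]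
      with n h3 h4 h5 h6
    refine h3.trans_le (hmono h6.2 (le_csSup ⟨m' n, fun M hM => ?_⟩ h4))
    by_contra hcon
    exact h5 M (not_le.mp hcon).le hM
  · obtain ⟨w, hw₁, hw₂⟩ := exists_between (show -(x * D') < wc by
      rw [gt_iff_lt, div_lt_iff₀ hDQ] at hx
      linarith)
    obtain ⟨m, h1, h2⟩ := hup w hw₂
    have hxw : -w / D' < x := by
      rw [div_lt_iff₀ hDQ]
      linarith
    filter_upwards [(hrate h1).eventually_lt_const hxw, h2, ht.eventually_pos] with n h3 h4 h5
    refine (hmono h5.2 (csSup_le' fun M hM => ?_)).trans_lt h3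
    by_contra hcon
    exact h4 M (not_le.mp hcon).le hM

section Embedding

variable {d N : ℕ} {c : Fin d → ℕ}

theorem sum_embed_mul (hc : ∀ i, 0 < c i) (a g : Fin d → ℝ) :
    ∑ x, embed c a x * g x.1 = ∑ i, a i * g i := by
  rw [Fintype.sum_sigma]
  refine sum_congr rfl fun i _ => ?_
  have hi : (c i : ℝ) ≠ 0 := by exact_mod_cast (hc i).ne'
  simp only [embed, sum_const, card_univ, Fintype.card_fin, nsmul_eq_mul]
  field_simp

theorem IsProbDist.embed (hc : ∀ i, 0 < c i) {a : Fin d → ℝ} (ha : IsProbDist a) :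
    IsProbDist (embed c a) := by
  refine ⟨fun x => div_nonneg (ha.1 _) (Nat.cast_nonneg _), ?_⟩
  simpa [ha.2] using sum_embed_mul hc a fun _ => 1

theorem card_mul_embed (hcN : ∑ i, c i = N) {γ : Fin d → ℝ}
    (hγ : ∀ i, γ i = (c i : ℝ) / (N : ℝ)) (a : Fin d → ℝ) (x : Σ i, Fin (c i)) :
    Fintype.card (Σ i, Fin (c i)) * _root_.embed c a x = a x.1 / γ x.1 := by
  rw [Fintype.card_sigma]
  simp only [Fintype.card_fin, hcN, hγ, _root_.embed, div_div_eq_mul_div]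
  ring

theorem relDUnif_embed (hc : ∀ i, 0 < c i) (hcN : ∑ i, c i = N) {γ : Fin d → ℝ}
    (hγ : ∀ i, γ i = (c i : ℝ) / (N : ℝ)) (a : Fin d → ℝ) :
    relDUnif (embed c a) = relD a γ := by
  simp only [relDUnif, card_mul_embed hcN hγ]
  exact sum_embed_mul hc a fun i => log (a i / γ i)

theorem relVUnif_embed (hc : ∀ i, 0 < c i) (hcN : ∑ i, c i = N) {γ : Fin d → ℝ}
    (hγ : ∀ i, γ i = (c i : ℝ) / (N : ℝ)) (a : Fin d → ℝ) :
    relVUnif (embed c a) = relV a γ := by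
  simp only [relVUnif, card_mul_embed hcN hγ, relDUnif_embed hc hcN hγ]
  exact sum_embed_mul hc a fun i => (log (a i / γ i) - relD a γ) ^ 2

end Embedding

theorem sqrt_mul_abs_one_sub_inv_sqrt {V D V' D' : ℝ} (hV : 0 < V) (hD : 0 < D) (hV' : 0 < V')
    (hD' : 0 < D') :
    √(2 * V) * |1 - 1 / √(V / D / (V' / D'))| = √2 * |√V - √(D / D' * V')| := by
  have h1 : V / D / (V' / D') = V / (D / D' * V') := by
    field_simp
  have h2 : 0 < √V := Real.sqrt_pos.mpr hV
  rw [h1, Real.sqrt_mul zero_le_two, Real.sqrt_div hV.le, one_div_div, mul_assoc]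
  congr 1
  rw [← abs_of_pos h2, ← abs_mul, abs_of_pos h2, mul_sub, mul_one, mul_div_cancel₀ _ h2.ne']

/-- Moderate deviation expansion of the optimal thermodynamic-direction conversion rate
(infidelity error, vanishing error `ε_n = e^{-n t_n²}`). -/
theorem thermodynamic_direction_moderate_deviation_fidelity
    {d N : ℕ} (c : Fin d → ℕ) (hcpos : ∀ i, 0 < c i) (hcN : ∑ i, c i = N)
    (γ : Fin d → ℝ) (hγprob : IsProbDist γ) (hγ : ∀ i, γ i = (c i : ℝ) / (N : ℝ))
    (p q : Fin d → ℝ) (hp : IsProbDist p) (hq : IsProbDist q)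
    (hDp : 0 < relD p γ) (hDq : 0 < relD q γ)
    (hVp : 0 < relV p γ) (hVq : 0 < relV q γ)
    (t : ℕ → ℝ) (ht : ModerateSeq t)
    (ε : ℕ → ℝ) (hε : ∀ n : ℕ, ε n = Real.exp (-((n : ℝ) * t n ^ 2)))
    (R : ℕ → ℝ → ℝ)
    (hR : ∀ n : ℕ, ∀ e : ℝ, 0 ≤ e → R n e =
      (↑(sSup {m : ℕ | ∃ Qt : (Fin m → (Σ i : Fin d, Fin (c i))) × (Fin n → Fin N) → ℝ,
          IsProbDist Qt ∧ Maj (tensor (tpow (embed c p) n) (tpow (unif N) m)) Qt ∧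
          1 - fid (tensor (tpow (embed c q) m) (tpow (unif N) n)) Qt ≤ e}) : ℝ) / (n : ℝ))
    (ν : ℝ) (hν : ν = (relV p γ / relD p γ) / (relV q γ / relD q γ)) :
    Tendsto (fun n : ℕ => (R n (ε n) - relD p γ / relD q γ) / t n) atTop
      (𝓝 (-(Real.sqrt (2 * relV p γ) / relD q γ) * |1 - 1 / Real.sqrt ν|)) := by
  have hN : N ≠ 0 := by
    rintro rfl
    have h0 : ∑ i, γ i = 0 := sum_eq_zero fun i _ => by simp [hγ]
    exact one_ne_zero (hγprob.2.symm.trans h0)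
  have : NeZero N := ⟨hN⟩
  have hcard : Fintype.card (Σ i : Fin d, Fin (c i)) = N := by
    rw [Fintype.card_sigma]
    simpa using hcN
  have : Nonempty (Σ i : Fin d, Fin (c i)) :=
    Fintype.card_pos_iff.mp (hcard ▸ Nat.pos_of_ne_zero hN)
  have hD := relDUnif_embed hcpos hcN hγ
  have hV := relVUnif_embed hcpos hcN hγ
  have h := tendsto_sSup_convertible (hp.embed hcpos) (hq.embed hcpos) hcard hcard
    (by rwa [hD]) (by rwa [hD]) (by rwa [hV]) (by rwa [hV]) ht
  rw [hD, hD, hV, hV, ← sqrt_mul_abs_one_sub_inv_sqrt hVp hDp hVq hDq, ← hν, neg_div,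
    mul_div_right_comm, ← neg_mul] at h
  refine h.congr fun n => ?_
  rw [hε, hR n _ (Real.exp_pos _).le]
  rfl
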